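/- Let γ : ℝ → ℝ^d be a smooth well-curved curve, let α > 0 and β > 0, and let 1 < p < ∞ satisfy α(d+1)/β < 1 − 2|1/p − 1/2|. Then T_γ is bounded on L^p(ℝ^d): there is a constant C such that ‖T_γ f‖_{L^p(ℝ^d)} ≤ C ‖f‖_{L^p(ℝ^d)} for all Schwartz functions f. -/

import Mathlib

open MeasureTheory Real Filter
open scoped Topology ENNReal

/-- A smooth curve `γ : ℝ → ℝ^d` is *well-curved* if `γ(0) = 0` and the derivatives
`γ^{(k)}(0)`, `k ≥ 1`, span `ℝ^d`. -/
def IsWellCurved (d : ℕ) (γ : ℝ → EuclideanSpace ℝ (Fin d)) : Prop :=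
  ContDiff ℝ (⊤ : ℕ∞) γ ∧ γ 0 = 0 ∧
    Submodule.span ℝ (Set.range fun k : ℕ => iteratedDeriv (k + 1) γ 0) = ⊤

/-- `T : f ↦ Tf` is the strongly singular integral along `γ` with kernel
`H_{α,β}(t) = t⁻¹|t|^{-α} e^{i|t|^{-β}}` if, for every Schwartz `f` and every `x`,
`Tf(x)` is the limit as `ε → 0⁺` of `∫_{ε ≤ |t| ≤ 1} H_{α,β}(t) f(x - γ(t)) dt`. -/
def IsStronglySingularIntegralAlong (d : ℕ) (γ : ℝ → EuclideanSpace ℝ (Fin d))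
    (α β : ℝ)
    (T : SchwartzMap (EuclideanSpace ℝ (Fin d)) ℂ → EuclideanSpace ℝ (Fin d) → ℂ) :
    Prop :=
  ∀ (f : SchwartzMap (EuclideanSpace ℝ (Fin d)) ℂ) (x : EuclideanSpace ℝ (Fin d)),
    Tendsto
      (fun ε : ℝ => ∫ t in {t : ℝ | ε ≤ |t| ∧ |t| ≤ 1},
        (t : ℂ)⁻¹ * ((|t| ^ (-α) : ℝ) : ℂ) *
          Complex.exp (Complex.I * ((|t| ^ (-β) : ℝ) : ℂ)) * f (x - γ t))
      (𝓝[>] 0) (𝓝 (T f x))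

/-- Integration by parts estimate for an oscillatory integral without critical points. -/
theorem norm_integral_exp_phase_le {φ φ₁ φ₂ : ℝ → ℝ} {a b μ : ℝ} (hab : a ≤ b) (hμ : 0 < μ)
    (h₀ : ∀ u, HasDerivAt φ (φ₁ u) u) (h₁ : ∀ u, HasDerivAt φ₁ (φ₂ u) u) (h₂ : Continuous φ₂)
    (hlow : ∀ u ∈ Set.Icc a b, μ ≤ |φ₁ u|) :
    ‖∫ u in a..b, Complex.exp (Complex.I * (φ u : ℂ))‖ ≤
      2 / μ + ∫ u in a..b, |φ₂ u| / φ₁ u ^ 2 := by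
  have c₀ : Continuous φ := continuous_iff_continuousAt.2 fun u => (h₀ u).continuousAt
  have c₁ : Continuous φ₁ := continuous_iff_continuousAt.2 fun u => (h₁ u).continuousAt
  have hne : ∀ u ∈ Set.Icc a b, φ₁ u ≠ 0 := fun u hu h => by
    have := hlow u hu
    rw [h, abs_zero] at this
    linarith
  have hnorm : ∀ u, ‖Complex.exp (Complex.I * (φ u : ℂ))‖ = 1 := fun u => by
    rw [mul_comm, Complex.norm_exp_ofReal_mul_I]
  let E : ℝ → ℂ := fun u => Complex.exp (Complex.I * (φ u : ℂ))
  let w : ℝ → ℂ := fun u => E u / (Complex.I * (φ₁ u : ℂ))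
  let r : ℝ → ℂ := fun u => E u * (φ₂ u : ℂ) / (Complex.I * (φ₁ u : ℂ) ^ 2)
  have hE : Continuous E := by fun_prop
  have hw : ∀ u ∈ Set.uIcc a b, HasDerivAt w (E u - r u) u := by
    intro u hu
    rw [Set.uIcc_of_le hab] at hu
    have hne' : (φ₁ u : ℂ) ≠ 0 := by exact_mod_cast hne u hu
    have hEu : HasDerivAt E (E u * (Complex.I * (φ₁ u : ℂ))) u :=
      (((h₀ u).ofReal_comp).const_mul Complex.I).cexp
    have hd := hEu.div (((h₁ u).ofReal_comp).const_mul Complex.I)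
      (mul_ne_zero Complex.I_ne_zero hne')
    refine hd.congr_deriv ?_
    have := Complex.I_ne_zero
    simp only [r]
    field_simp
  have hrc : ContinuousOn r (Set.Icc a b) := by
    apply ContinuousOn.div
    · exact (hE.mul (Complex.continuous_ofReal.comp h₂)).continuousOn
    · fun_prop
    · intro u hu
      have hne' : (φ₁ u : ℂ) ≠ 0 := by exact_mod_cast hne u hu
      exact mul_ne_zero Complex.I_ne_zero (pow_ne_zero _ hne')
  have hri : IntervalIntegrable r volume a b := by
    apply ContinuousOn.intervalIntegrable
    rwa [Set.uIcc_of_le hab]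
  have hEi : IntervalIntegrable E volume a b := hE.intervalIntegrable _ _
  have hFTC := intervalIntegral.integral_eq_sub_of_hasDerivAt hw (hEi.sub hri)
  rw [intervalIntegral.integral_sub hEi hri] at hFTC
  have hEq : (∫ u in a..b, E u) = (w b - w a) + ∫ u in a..b, r u := by
    rw [← hFTC]; ring
  have hwle : ∀ u ∈ Set.Icc a b, ‖w u‖ ≤ 1 / μ := by
    intro u hu
    simp only [w, E, norm_div, norm_mul, hnorm, Complex.norm_I, one_mul, Complex.norm_real,
      Real.norm_eq_abs]
    exact one_div_le_one_div_of_le hμ (hlow u hu)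
  have hrle : ‖∫ u in a..b, r u‖ ≤ ∫ u in a..b, |φ₂ u| / φ₁ u ^ 2 := by
    refine (intervalIntegral.norm_integral_le_integral_norm hab).trans (le_of_eq ?_)
    congr 1
    funext u
    simp only [r, E, norm_div, norm_mul, hnorm, Complex.norm_I, one_mul, Complex.norm_real,
      Real.norm_eq_abs, norm_pow, sq_abs]
  change ‖∫ u in a..b, E u‖ ≤ _
  rw [hEq]
  calc _ ≤ (‖w b‖ + ‖w a‖) + ‖∫ u in a..b, r u‖ :=
        (norm_add_le _ _).trans (by gcongr; exact norm_sub_le _ _)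
    _ ≤ (1 / μ + 1 / μ) + ∫ u in a..b, |φ₂ u| / φ₁ u ^ 2 := by
        gcongr
        · exact hwle b ⟨hab, le_rfl⟩
        · exact hwle a ⟨le_rfl, hab⟩
    _ = _ := by ring

theorem norm_integral_exp_phase_le_length {φ : ℝ → ℝ} {a b : ℝ} (hab : a ≤ b) :
    ‖∫ u in a..b, Complex.exp (Complex.I * (φ u : ℂ))‖ ≤ b - a := by
  refine (intervalIntegral.norm_integral_le_of_norm_le_const (C := 1) fun u _ => ?_).trans ?_
  · rw [mul_comm, Complex.norm_exp_ofReal_mul_I]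
  · rw [one_mul, abs_of_nonneg (sub_nonneg.2 hab)]

/-- First derivative estimate with monotone derivative. -/
theorem norm_integral_exp_phase_le_of_monotone {φ φ₁ φ₂ : ℝ → ℝ} {a b μ : ℝ} (hab : a ≤ b)
    (hμ : 0 < μ) (h₀ : ∀ u, HasDerivAt φ (φ₁ u) u) (h₁ : ∀ u, HasDerivAt φ₁ (φ₂ u) u)
    (h₂ : Continuous φ₂) (hlow : ∀ u ∈ Set.Icc a b, μ ≤ |φ₁ u|)
    (hsign : (∀ u ∈ Set.Icc a b, 0 ≤ φ₂ u) ∨ ∀ u ∈ Set.Icc a b, φ₂ u ≤ 0) :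
    ‖∫ u in a..b, Complex.exp (Complex.I * (φ u : ℂ))‖ ≤ 4 / μ := by
  refine (norm_integral_exp_phase_le hab hμ h₀ h₁ h₂ hlow).trans ?_
  have c₁ : Continuous φ₁ := continuous_iff_continuousAt.2 fun u => (h₁ u).continuousAt
  have hne : ∀ u ∈ Set.Icc a b, φ₁ u ≠ 0 := fun u hu h => by
    have := hlow u hu
    rw [h, abs_zero] at this
    linarith
  have hinv : ∀ u ∈ Set.Icc a b, |(φ₁ u)⁻¹| ≤ 1 / μ := fun u hu => by
    rw [abs_inv, ← one_div]
    exact one_div_le_one_div_of_le hμ (hlow u hu)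
  have hFTC : ∫ u in a..b, -φ₂ u / φ₁ u ^ 2 = (φ₁ b)⁻¹ - (φ₁ a)⁻¹ := by
    apply intervalIntegral.integral_eq_sub_of_hasDerivAt (f := fun u => (φ₁ u)⁻¹)
    · intro u hu
      rw [Set.uIcc_of_le hab] at hu
      exact (h₁ u).inv (hne u hu)
    · apply ContinuousOn.intervalIntegrable
      rw [Set.uIcc_of_le hab]
      exact (h₂.neg.continuousOn).div (c₁.pow 2).continuousOn fun u hu => pow_ne_zero _ (hne u hu)
  have hbound : |∫ u in a..b, -φ₂ u / φ₁ u ^ 2| ≤ 2 / μ := by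
    rw [hFTC]
    calc _ ≤ |(φ₁ b)⁻¹| + |(φ₁ a)⁻¹| := abs_sub _ _
      _ ≤ 1 / μ + 1 / μ := add_le_add (hinv b ⟨hab, le_rfl⟩) (hinv a ⟨le_rfl, hab⟩)
      _ = _ := by ring
  have hval : (∫ u in a..b, |φ₂ u| / φ₁ u ^ 2) ≤ |∫ u in a..b, -φ₂ u / φ₁ u ^ 2| := by
    rcases hsign with hs | hs
    · rw [← abs_neg, ← intervalIntegral.integral_neg]
      refine (le_of_eq ?_).trans (le_abs_self _)
      apply intervalIntegral.integral_congr
      intro u hu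
      rw [Set.uIcc_of_le hab] at hu
      simp only [abs_of_nonneg (hs u hu)]
      ring
    · refine (le_of_eq ?_).trans (le_abs_self _)
      apply intervalIntegral.integral_congr
      intro u hu
      rw [Set.uIcc_of_le hab] at hu
      simp only [abs_of_nonpos (hs u hu)]
  calc _ ≤ 2 / μ + 2 / μ := by gcongr; exact hval.trans hbound
    _ = _ := by ring

/-- A function whose derivative is bounded away from zero is comparable to the distance to
a point. -/
theorem exists_mul_abs_sub_le_of_deriv {g g' : ℝ → ℝ} {a b μ : ℝ} (hab : a ≤ b)
    (hg : ∀ u, HasDerivAt g (g' u) u) (hlow : ∀ u ∈ Set.Icc a b, μ ≤ g' u) :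
    ∃ c ∈ Set.Icc a b, ∀ u ∈ Set.Icc a b, μ * |u - c| ≤ |g u| := by
  have cg : Continuous g := continuous_iff_continuousAt.2 fun u => (hg u).continuousAt
  have hmono : ∀ u ∈ Set.Icc a b, ∀ v ∈ Set.Icc a b, u ≤ v → μ * (v - u) ≤ g v - g u := by
    intro u hu v hv huv
    apply Convex.mul_sub_le_image_sub_of_le_deriv (convex_Icc a b) cg.continuousOn
      (fun x _ => (hg x).differentiableAt.differentiableWithinAt) _ u hu v hv huv
    intro x hx
    rw [(hg x).deriv]
    exact hlow x (interior_subset hx)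
  have ha : a ∈ Set.Icc a b := ⟨le_rfl, hab⟩
  have hb : b ∈ Set.Icc a b := ⟨hab, le_rfl⟩
  by_cases h1 : 0 ≤ g a
  · refine ⟨a, ha, fun u hu => ?_⟩
    have := hmono a ha u hu hu.1
    rw [abs_of_nonneg (sub_nonneg.2 hu.1)]
    exact le_trans (by linarith) (le_abs_self _)
  by_cases h2 : g b ≤ 0
  · refine ⟨b, hb, fun u hu => ?_⟩
    have := hmono u hu b hb hu.2
    rw [abs_of_nonpos (sub_nonpos.2 hu.2)]
    exact le_trans (by linarith) (neg_le_abs _)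
  push Not at h1 h2
  obtain ⟨c, hc, hc0⟩ := intermediate_value_Icc hab cg.continuousOn ⟨h1.le, h2.le⟩
  refine ⟨c, hc, fun u hu => ?_⟩
  rcases le_total c u with h | h
  · have := hmono c hc u hu h
    rw [abs_of_nonneg (sub_nonneg.2 h)]
    exact le_trans (by linarith) (le_abs_self _)
  · have := hmono u hu c hc h
    rw [abs_of_nonpos (sub_nonpos.2 h)]
    exact le_trans (by linarith) (neg_le_abs _)

/-- A continuous function bounded away from zero on an interval has constant sign there. -/
theorem sign_const_of_le_abs {g : ℝ → ℝ} {a b μ : ℝ} (hμ : 0 < μ) (hg : Continuous g)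
    (hlow : ∀ u ∈ Set.Icc a b, μ ≤ |g u|) :
    (∀ u ∈ Set.Icc a b, μ ≤ g u) ∨ ∀ u ∈ Set.Icc a b, μ ≤ -g u := by
  by_contra! hcon
  obtain ⟨⟨u, hu, hgu⟩, v, hv, hgv⟩ := hcon
  have h1 : g u < 0 := by
    by_contra! h
    have := hlow u hu
    rw [abs_of_nonneg h] at this
    linarith
  have h2 : 0 < g v := by
    by_contra! h
    have := hlow v hv
    rw [abs_of_nonpos h] at this
    linarith
  obtain ⟨c, hc, hc0⟩ := (isPreconnected_Icc (a := a) (b := b)).intermediate_value hu hv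
    hg.continuousOn ⟨h1.le, h2.le⟩
  have := hlow c hc
  rw [hc0, abs_zero] at this
  exact absurd hμ (not_lt.2 this)

theorem rpow_neg_inv_split {μ : ℝ} (hμ : 0 < μ) (k : ℕ) (hk : 1 ≤ k) :
    (μ * μ ^ (-((k : ℝ) + 1)⁻¹)) ^ (-(k : ℝ)⁻¹) = μ ^ (-((k : ℝ) + 1)⁻¹) := by
  have hk' : (0 : ℝ) < k := by exact_mod_cast hk
  nth_rewrite 1 [← Real.rpow_one μ]
  rw [← Real.rpow_add hμ, ← Real.rpow_mul hμ.le]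
  congr 1
  field_simp
  ring

/-- The inductive step in van der Corput's lemma. -/
theorem vanDerCorput_step {Φ : ℕ → ℝ → ℝ} (hΦ : ∀ k u, HasDerivAt (Φ k) (Φ (k + 1) u) u)
    {k : ℕ} (hk : 1 ≤ k) {C : ℝ} (hC : 0 ≤ C)
    (ih : ∀ a b μ : ℝ, a ≤ b → 0 < μ → (∀ u ∈ Set.Icc a b, μ ≤ |Φ k u|) →
      ((∀ u ∈ Set.Icc a b, 0 ≤ Φ (k + 1) u) ∨ ∀ u ∈ Set.Icc a b, Φ (k + 1) u ≤ 0) →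
      ‖∫ u in a..b, Complex.exp (Complex.I * (Φ 0 u : ℂ))‖ ≤ C * μ ^ (-(k : ℝ)⁻¹))
    {a b μ : ℝ} (hab : a ≤ b) (hμ : 0 < μ) (hlow : ∀ u ∈ Set.Icc a b, μ ≤ |Φ (k + 1) u|) :
    ‖∫ u in a..b, Complex.exp (Complex.I * (Φ 0 u : ℂ))‖ ≤
      (2 + 2 * C) * μ ^ (-((k : ℝ) + 1)⁻¹) := by
  have cΦ : ∀ k, Continuous (Φ k) := fun k =>
    continuous_iff_continuousAt.2 fun u => (hΦ k u).continuousAt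
  have hE : Continuous fun u => Complex.exp (Complex.I * (Φ 0 u : ℂ)) := by
    have := cΦ 0
    fun_prop
  have hsgn := sign_const_of_le_abs hμ (cΦ (k + 1)) hlow
  have hsgn' : (∀ u ∈ Set.Icc a b, 0 ≤ Φ (k + 1) u) ∨ ∀ u ∈ Set.Icc a b, Φ (k + 1) u ≤ 0 :=
    hsgn.imp (fun h u hu => hμ.le.trans (h u hu)) fun h u hu => by linarith [h u hu]
  obtain ⟨c, hc, hcd⟩ : ∃ c ∈ Set.Icc a b, ∀ u ∈ Set.Icc a b, μ * |u - c| ≤ |Φ k u| := by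
    rcases hsgn with h | h
    · exact exists_mul_abs_sub_le_of_deriv hab (hΦ k) h
    · obtain ⟨c, hc, h'⟩ := exists_mul_abs_sub_le_of_deriv hab (fun u => (hΦ k u).neg) h
      exact ⟨c, hc, fun u hu => by simpa using h' u hu⟩
  set δ := μ ^ (-((k : ℝ) + 1)⁻¹) with hδ
  have hδ0 : 0 < δ := Real.rpow_pos_of_pos hμ _
  have hpow : (μ * δ) ^ (-(k : ℝ)⁻¹) = δ := rpow_neg_inv_split hμ k hk
  have hsub : ∀ a' b', a ≤ a' → a' ≤ b' → b' ≤ b → (∀ u ∈ Set.Icc a' b', δ ≤ |u - c|) →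
      ‖∫ u in a'..b', Complex.exp (Complex.I * (Φ 0 u : ℂ))‖ ≤ C * δ := by
    intro a' b' h1 h2 h3 h4
    have hss : ∀ u ∈ Set.Icc a' b', u ∈ Set.Icc a b := fun u hu =>
      ⟨h1.trans hu.1, hu.2.trans h3⟩
    have := ih a' b' (μ * δ) h2 (mul_pos hμ hδ0)
      (fun u hu => (mul_le_mul_of_nonneg_left (h4 u hu) hμ.le).trans (hcd u (hss u hu)))
      (hsgn'.imp (fun h u hu => h u (hss u hu)) fun h u hu => h u (hss u hu))
    rwa [hpow] at this
  have hC' : 0 ≤ C * δ := mul_nonneg hC hδ0.le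
  have hint : ∀ a' b', IntervalIntegrable
      (fun u => Complex.exp (Complex.I * (Φ 0 u : ℂ))) volume a' b' :=
    fun a' b' => hE.intervalIntegrable _ _
  have hright : ‖∫ u in c..b, Complex.exp (Complex.I * (Φ 0 u : ℂ))‖ ≤ δ + C * δ := by
    rcases le_total b (c + δ) with h | h
    · exact (norm_integral_exp_phase_le_length hc.2).trans (by linarith)
    · rw [← intervalIntegral.integral_add_adjacent_intervals (hint c (c + δ)) (hint _ b)]
      refine (norm_add_le _ _).trans (add_le_add ?_ ?_)
      · exact (norm_integral_exp_phase_le_length (by linarith)).trans (by linarith)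
      · exact hsub _ _ (by linarith [hc.1]) h le_rfl fun u hu =>
          le_trans (by linarith [hu.1]) (le_abs_self _)
  have hleft : ‖∫ u in a..c, Complex.exp (Complex.I * (Φ 0 u : ℂ))‖ ≤ δ + C * δ := by
    rcases le_total (c - δ) a with h | h
    · exact (norm_integral_exp_phase_le_length hc.1).trans (by linarith)
    · rw [← intervalIntegral.integral_add_adjacent_intervals (hint a (c - δ)) (hint _ c), add_comm]
      refine (norm_add_le _ _).trans (add_le_add ?_ ?_)
      · exact (norm_integral_exp_phase_le_length (by linarith)).trans (by linarith)
      · exact hsub _ _ le_rfl h (by linarith [hc.2]) fun u hu =>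
          le_trans (by linarith [hu.2]) (neg_le_abs _)
  rw [← intervalIntegral.integral_add_adjacent_intervals (hint a c) (hint c b)]
  calc _ ≤ (δ + C * δ) + (δ + C * δ) := (norm_add_le _ _).trans (add_le_add hleft hright)
    _ = _ := by ring

theorem vanDerCorput_of_sign (k : ℕ) : ∃ C : ℝ, 0 ≤ C ∧ ∀ Φ : ℕ → ℝ → ℝ,
    (∀ k u, HasDerivAt (Φ k) (Φ (k + 1) u) u) → ∀ a b μ : ℝ, a ≤ b → 0 < μ →
      (∀ u ∈ Set.Icc a b, μ ≤ |Φ (k + 1) u|) →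
      ((∀ u ∈ Set.Icc a b, 0 ≤ Φ (k + 2) u) ∨ ∀ u ∈ Set.Icc a b, Φ (k + 2) u ≤ 0) →
      ‖∫ u in a..b, Complex.exp (Complex.I * (Φ 0 u : ℂ))‖ ≤ C * μ ^ (-((k : ℝ) + 1)⁻¹) := by
  induction k with
  | zero =>
    refine ⟨4, by norm_num, fun Φ hΦ a b μ hab hμ hlow hs => ?_⟩
    have h2 : Continuous (Φ 2) := continuous_iff_continuousAt.2 fun u => (hΦ 2 u).continuousAt
    refine (norm_integral_exp_phase_le_of_monotone hab hμ (hΦ 0) (hΦ 1) h2 hlow hs).trans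
      (le_of_eq ?_)
    simp [Real.rpow_neg_one, div_eq_mul_inv]
  | succ k ih =>
    obtain ⟨C, hC, ih⟩ := ih
    refine ⟨2 + 2 * C, by positivity, fun Φ hΦ a b μ hab hμ hlow _ => ?_⟩
    have := vanDerCorput_step hΦ (k := k + 1) (by omega) hC
      (by push_cast; exact ih Φ hΦ) hab hμ hlow
    exact this

/-- Van der Corput's lemma: for `k ≥ 2` no monotonicity is required. -/
theorem vanDerCorput (k : ℕ) : ∃ C : ℝ, 0 ≤ C ∧ ∀ Φ : ℕ → ℝ → ℝ,
    (∀ k u, HasDerivAt (Φ k) (Φ (k + 1) u) u) → ∀ a b μ : ℝ, a ≤ b → 0 < μ →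
      (∀ u ∈ Set.Icc a b, μ ≤ |Φ (k + 2) u|) →
      ‖∫ u in a..b, Complex.exp (Complex.I * (Φ 0 u : ℂ))‖ ≤ C * μ ^ (-((k : ℝ) + 2)⁻¹) := by
  obtain ⟨C, hC, h⟩ := vanDerCorput_of_sign k
  refine ⟨2 + 2 * C, by positivity, fun Φ hΦ a b μ hab hμ hlow => ?_⟩
  have := vanDerCorput_step hΦ (k := k + 1) (by omega) hC
    (by push_cast; exact h Φ hΦ) hab hμ hlow
  convert this using 4
  push_cast
  ring

/-- Lower bound for generalized Vandermonde systems with nonzero distinct nodes. -/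
theorem exists_vandermonde_lower_bound {m : ℕ} {e : Fin m → ℝ} (he : Function.Injective e)
    (he0 : ∀ i, e i ≠ 0) (hm : 0 < m) :
    ∃ c : ℝ, 0 < c ∧ ∀ x : Fin m → ℝ,
      ∃ k : ℕ, k < m ∧ c * ∑ i, |x i| ≤ |∑ i, e i ^ (k + 1) * x i| := by
  let A : Matrix (Fin m) (Fin m) ℝ := (Matrix.of fun i j => e i * Matrix.vandermonde e i j).transpose
  have hA : IsUnit A := by
    rw [Matrix.isUnit_iff_isUnit_det, isUnit_iff_ne_zero, Matrix.det_transpose,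
      Matrix.det_mul_column]
    exact mul_ne_zero (Finset.prod_ne_zero_iff.2 fun i _ => he0 i)
      (Matrix.det_vandermonde_ne_zero_iff.2 he)
  have hinj : Function.Injective (Matrix.mulVecLin A) :=
    Matrix.mulVec_injective_iff_isUnit.2 hA
  obtain ⟨K, hK, hanti⟩ := (LinearMap.injective_iff_antilipschitz _).1 hinj
  have hK' : (0 : ℝ) < K := by exact_mod_cast hK
  have hm' : (0 : ℝ) < m := by exact_mod_cast hm
  refine ⟨(m * K)⁻¹, by positivity, fun x => ?_⟩
  have hx : ‖x‖ ≤ K * ‖Matrix.mulVecLin A x‖ := by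
    simpa [dist_eq_norm] using hanti.le_mul_dist x 0
  have : Nonempty (Fin m) := ⟨⟨0, hm⟩⟩
  obtain ⟨k, -, hk⟩ := Finset.exists_max_image Finset.univ (fun k => ‖Matrix.mulVecLin A x k‖)
    Finset.univ_nonempty
  refine ⟨k, k.2, ?_⟩
  have hval : Matrix.mulVecLin A x k = ∑ i, e i ^ ((k : ℕ) + 1) * x i := by
    simp only [Matrix.mulVecLin_apply, Matrix.mulVec, dotProduct, A, Matrix.transpose_apply,
      Matrix.of_apply, Matrix.vandermonde_apply, pow_succ']
  have hmax : ‖Matrix.mulVecLin A x‖ ≤ |∑ i, e i ^ ((k : ℕ) + 1) * x i| := by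
    rw [← hval, ← Real.norm_eq_abs]
    exact (pi_norm_le_iff_of_nonneg (norm_nonneg _)).2 fun i => hk i (Finset.mem_univ _)
  have hsum : ∑ i, |x i| ≤ m * ‖x‖ := by
    calc ∑ i, |x i| ≤ ∑ _i : Fin m, ‖x‖ :=
          Finset.sum_le_sum fun i _ => by simpa using norm_le_pi_norm x i
      _ = _ := by simp
  rw [inv_mul_le_iff₀ (by positivity)]
  calc _ ≤ m * ‖x‖ := hsum
    _ ≤ m * (K * |∑ i, e i ^ ((k : ℕ) + 1) * x i|) := by
        gcongr
        exact hx.trans (by gcongr)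
    _ = _ := by ring

/-- Iterates of the Euler operator `t d/dt`. -/
noncomputable def eulerIter (F : ℝ → ℝ) : ℕ → ℝ → ℝ
  | 0 => F
  | k + 1 => fun t => t * deriv (eulerIter F k) t

theorem contDiff_eulerIter {F : ℝ → ℝ} (hF : ContDiff ℝ (⊤ : ℕ∞) F) (k : ℕ) :
    ContDiff ℝ (⊤ : ℕ∞) (eulerIter F k) := by
  induction k with
  | zero => exact hF
  | succ k ih =>
    have h : ContDiff ℝ (⊤ : ℕ∞) (deriv (eulerIter F k)) := by
      have := (contDiff_infty_iff_deriv (𝕜 := ℝ)).1 ih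
      exact this.2
    exact contDiff_id.mul h

theorem hasDerivAt_eulerIter_exp {F : ℝ → ℝ} (hF : ContDiff ℝ (⊤ : ℕ∞) F) (k : ℕ) (u : ℝ) :
    HasDerivAt (fun u => (-1) ^ k * eulerIter F k (Real.exp (-u)))
      ((-1) ^ (k + 1) * eulerIter F (k + 1) (Real.exp (-u))) u := by
  have h1 : HasDerivAt (eulerIter F k) (deriv (eulerIter F k) (Real.exp (-u))) (Real.exp (-u)) :=
    ((contDiff_eulerIter hF k).differentiable (by simp)).differentiableAt.hasDerivAt
  have h2 : HasDerivAt (fun u : ℝ => Real.exp (-u)) (Real.exp (-u) * -1) u :=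
    (hasDerivAt_neg u).exp
  refine ((h1.comp u h2).const_mul ((-1 : ℝ) ^ k)).congr_deriv ?_
  simp only [eulerIter]
  ring

theorem iteratedDeriv_id_mul_deriv_zero {F : ℝ → ℝ} (hF : ContDiff ℝ (⊤ : ℕ∞) F) (k : ℕ) :
    iteratedDeriv k (fun t => t * deriv F t) 0 = k * iteratedDeriv k F 0 := by
  have hsm : ∀ k, ContDiff ℝ (⊤ : ℕ∞) (iteratedDeriv k F) := fun k => by
    induction k with
    | zero => simpa using hF
    | succ k ih => rw [iteratedDeriv_succ]; exact ((contDiff_infty_iff_deriv (𝕜 := ℝ)).1 ih).2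
  have key : ∀ k, iteratedDeriv k (fun t => t * deriv F t) =
      fun t => t * iteratedDeriv (k + 1) F t + k * iteratedDeriv k F t := by
    intro k
    induction k with
    | zero => funext t; simp [iteratedDeriv_one]
    | succ k ih =>
      rw [iteratedDeriv_succ, ih]
      funext t
      have hd : ∀ k, HasDerivAt (iteratedDeriv k F) (iteratedDeriv (k + 1) F t) t := fun k => by
        rw [iteratedDeriv_succ]
        exact ((hsm k).differentiable (by simp)).differentiableAt.hasDerivAt
      have := (((hasDerivAt_id t).mul (hd (k + 1))).add ((hd k).const_mul (k : ℝ))).deriv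
      refine this.trans ?_
      push_cast
      simp only [id]
      ring
  rw [key]
  simp

theorem iteratedDeriv_eulerIter_zero {F : ℝ → ℝ} (hF : ContDiff ℝ (⊤ : ℕ∞) F) (k j : ℕ) :
    iteratedDeriv j (eulerIter F k) 0 = (j : ℝ) ^ k * iteratedDeriv j F 0 := by
  induction k with
  | zero => simp [eulerIter]
  | succ k ih =>
    rw [eulerIter, iteratedDeriv_id_mul_deriv_zero (contDiff_eulerIter hF k), ih]
    ring

/-- Leading term of a function vanishing to order `a` at the origin. -/
theorem exists_leading_term_bound {F : ℝ → ℝ} (hF : ContDiff ℝ (⊤ : ℕ∞) F) {a : ℕ}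
    (hvan : ∀ k < a, iteratedDeriv k F 0 = 0) :
    ∃ K : ℝ, 0 ≤ K ∧ ∀ t ∈ Set.Icc (0 : ℝ) 1,
      |F t - iteratedDeriv a F 0 / a.factorial * t ^ a| ≤ K * t ^ (a + 1) := by
  obtain ⟨C, hC⟩ := exists_taylor_mean_remainder_bound (f := F) (a := 0) (b := 1) (n := a)
    zero_le_one (hF.of_le (by exact_mod_cast le_top)).contDiffOn
  refine ⟨max C 0, le_max_right _ _, fun t ht => ?_⟩
  have := hC t ht
  have hT : taylorWithinEval F a (Set.Icc 0 1) 0 t = iteratedDeriv a F 0 / a.factorial * t ^ a := by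
    rw [taylor_within_apply, Finset.sum_range_succ, Finset.sum_eq_zero, zero_add]
    · rw [iteratedDerivWithin_eq_iteratedDeriv (uniqueDiffOn_Icc zero_lt_one)
        (hF.of_le (by exact_mod_cast le_top)).contDiffAt ⟨le_rfl, zero_le_one⟩]
      simp only [sub_zero, smul_eq_mul]
      field_simp
    · intro k hk
      rw [iteratedDerivWithin_eq_iteratedDeriv (uniqueDiffOn_Icc zero_lt_one)
        (hF.of_le (by exact_mod_cast le_top)).contDiffAt ⟨le_rfl, zero_le_one⟩,
        hvan k (Finset.mem_range.1 hk), smul_zero]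
  rw [hT, Real.norm_eq_abs, sub_zero] at this
  refine this.trans ?_
  have := ht.1
  gcongr
  exact le_max_left _ _

theorem exists_eulerIter_bound {F : ℝ → ℝ} (hF : ContDiff ℝ (⊤ : ℕ∞) F) {a : ℕ}
    (hvan : ∀ k < a, iteratedDeriv k F 0 = 0) (N : ℕ) :
    ∃ K : ℝ, 0 ≤ K ∧ ∀ k ≤ N, ∀ t ∈ Set.Icc (0 : ℝ) 1,
      |eulerIter F k t - (a : ℝ) ^ k * (iteratedDeriv a F 0 / a.factorial) * t ^ a| ≤
        K * t ^ (a + 1) := by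
  have h : ∀ k, ∃ K : ℝ, 0 ≤ K ∧ ∀ t ∈ Set.Icc (0 : ℝ) 1,
      |eulerIter F k t - (a : ℝ) ^ k * (iteratedDeriv a F 0 / a.factorial) * t ^ a| ≤
        K * t ^ (a + 1) := by
    intro k
    obtain ⟨K, hK, h⟩ := exists_leading_term_bound (contDiff_eulerIter hF k) (a := a)
      fun j hj => by rw [iteratedDeriv_eulerIter_zero hF, hvan j hj, mul_zero]
    refine ⟨K, hK, fun t ht => ?_⟩
    have := h t ht
    rwa [iteratedDeriv_eulerIter_zero hF, mul_div_assoc] at this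
  choose K hK h using h
  refine ⟨∑ k ∈ Finset.range (N + 1), K k, Finset.sum_nonneg fun k _ => hK k,
    fun k hk t ht => (h k t ht).trans ?_⟩
  have := ht.1
  gcongr
  exact Finset.single_le_sum (f := K) (fun k _ => hK k) (Finset.mem_range.2 (by omega))

/-- Uniform decay of oscillatory integrals over short intervals when the derivatives of the phase
are perturbations of those of an exponential sum. -/
theorem exists_oscillatory_bound_of_perturbation {m : ℕ} (hm : 0 < m) {e : Fin m → ℝ}
    (he : Function.Injective e) (he0 : ∀ i, e i ≠ 0) (K : ℝ) (hK : 0 ≤ K) :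
    ∃ u₀ h C : ℝ, 0 < h ∧ 0 ≤ C ∧ ∀ (Φ : ℕ → ℝ → ℝ) (y : Fin m → ℝ),
      (∀ k u, HasDerivAt (Φ k) (Φ (k + 1) u) u) →
      (∀ s, 0 ≤ s → ∀ k ≤ m + 1, |Φ k s - ∑ i, e i ^ k * (y i * Real.exp (e i * s))| ≤
        K * Real.exp (-s) * ∑ i, |y i * Real.exp (e i * s)|) →
      ∀ u, 0 ≤ u → u₀ ≤ u → 1 ≤ ∑ i, |y i * Real.exp (e i * u)| → ∀ v ∈ Set.Icc u (u + h),
        ‖∫ s in u..v, Complex.exp (Complex.I * (Φ 0 s : ℂ))‖ ≤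
          C * (∑ i, |y i * Real.exp (e i * u)|) ^ (-(m : ℝ)⁻¹) := by
  obtain ⟨c, hc, hV⟩ := exists_vandermonde_lower_bound he he0 hm
  choose Cv hCv hvdc using vanDerCorput
  set D := ∑ i, |e i| with hD
  have hD0 : 0 ≤ D := Finset.sum_nonneg fun i _ => abs_nonneg _
  have heD : ∀ i, |e i| ≤ D := fun i =>
    Finset.single_le_sum (f := fun i => |e i|) (fun i _ => abs_nonneg _) (Finset.mem_univ i)
  set B := ((1 + D) ^ (m + 1) + K) * Real.exp D with hB
  have hB0 : 0 < B := by positivity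
  obtain ⟨u₀, hu₀⟩ : ∃ u₀ : ℝ, ∀ u, u₀ ≤ u → K * Real.exp (-u) ≤ c / 2 := by
    have ht : Tendsto (fun u : ℝ => K * Real.exp (-u)) atTop (𝓝 (K * 0)) :=
      (Real.tendsto_exp_neg_atTop_nhds_zero).const_mul K
    rw [mul_zero] at ht
    exact eventually_atTop.1 (ht.eventually (ge_mem_nhds (by positivity : (0 : ℝ) < c / 2)))
  set h := min 1 (c / (4 * B)) with hh
  have hh0 : 0 < h := lt_min one_pos (by positivity)
  have hh1 : h ≤ 1 := min_le_left _ _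
  have hhB : h * B ≤ c / 4 := by
    calc h * B ≤ c / (4 * B) * B := by gcongr; exact min_le_right _ _
      _ = c / 4 := by field_simp
  refine ⟨u₀, h, 12 / c + ∑ k ∈ Finset.range m, Cv k * (c / 4) ^ (-((k : ℝ) + 2)⁻¹), hh0,
    add_nonneg (by positivity) (Finset.sum_nonneg fun k _ =>
      mul_nonneg (hCv k) (by positivity)), ?_⟩
  intro Φ y hΦ happ u hu huu₀ hX1 v hv
  set X : ℝ → ℝ := fun s => ∑ i, |y i * Real.exp (e i * s)| with hX
  have hXnn : ∀ s, 0 ≤ X s := fun s => Finset.sum_nonneg fun i _ => abs_nonneg _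
  have hX1' : 1 ≤ X u := hX1
  have hX0 : 0 < X u := by linarith
  have cΦ : ∀ k, Continuous (Φ k) := fun k =>
    continuous_iff_continuousAt.2 fun u => (hΦ k u).continuousAt
  have hXs : ∀ s ∈ Set.Icc u (u + h), X s ≤ Real.exp D * X u := by
    intro s hs
    simp only [hX, Finset.mul_sum]
    refine Finset.sum_le_sum fun i _ => ?_
    rw [abs_mul, abs_mul, Real.abs_exp, Real.abs_exp, mul_left_comm, ← Real.exp_add]
    gcongr
    have : e i * (s - u) ≤ D * 1 := by
      calc e i * (s - u) ≤ |e i| * (s - u) := by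
            gcongr
            · linarith [hs.1]
            · exact le_abs_self _
        _ ≤ D * 1 := by
            gcongr
            · linarith [hs.1]
            · exact heD i
            · linarith [hs.2]
    linarith
  have hupper : ∀ k ≤ m + 1, ∀ s ∈ Set.Icc u (u + h), |Φ k s| ≤ B * X u := by
    intro k hk s hs
    have hs0 : 0 ≤ s := hu.trans hs.1
    have h1 := happ s hs0 k hk
    have h2 : |∑ i, e i ^ k * (y i * Real.exp (e i * s))| ≤ (1 + D) ^ (m + 1) * X s := by
      refine (Finset.abs_sum_le_sum_abs _ _).trans ?_
      rw [hX, Finset.mul_sum]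
      refine Finset.sum_le_sum fun i _ => ?_
      rw [abs_mul, abs_pow]
      gcongr
      calc |e i| ^ k ≤ (1 + D) ^ k := by
            gcongr
            linarith [heD i]
        _ ≤ (1 + D) ^ (m + 1) := pow_le_pow_right₀ (by linarith) hk
    have h3 : K * Real.exp (-s) * X s ≤ K * X s := by
      have : Real.exp (-s) ≤ 1 := Real.exp_le_one_iff.2 (by linarith)
      calc K * Real.exp (-s) * X s ≤ K * 1 * X s := by gcongr
        _ = _ := by ring
    have h4 := abs_sub_abs_le_abs_sub (Φ k s) (∑ i, e i ^ k * (y i * Real.exp (e i * s)))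
    calc |Φ k s| ≤ ((1 + D) ^ (m + 1) + K) * X s := by linarith
      _ ≤ ((1 + D) ^ (m + 1) + K) * (Real.exp D * X u) := by gcongr; exact hXs s hs
      _ = B * X u := by rw [hB]; ring
  obtain ⟨k, hk, hkV⟩ := hV fun i => y i * Real.exp (e i * u)
  have hlow0 : c / 2 * X u ≤ |Φ (k + 1) u| := by
    have h1 := happ u hu (k + 1) (by omega)
    have h2 := abs_sub_abs_le_abs_sub (∑ i, e i ^ (k + 1) * (y i * Real.exp (e i * u)))
      (Φ (k + 1) u)
    rw [abs_sub_comm] at h1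
    have h3 : K * Real.exp (-u) * X u ≤ c / 2 * X u := by gcongr; exact hu₀ u huu₀
    have h4 : c * X u ≤ |∑ i, e i ^ (k + 1) * (y i * Real.exp (e i * u))| := hkV
    have h5 : c / 2 * X u = c * X u - c / 2 * X u := by ring
    linarith
  have hlow : ∀ s ∈ Set.Icc u (u + h), c / 4 * X u ≤ |Φ (k + 1) s| := by
    intro s hs
    have hdiff : ‖Φ (k + 1) s - Φ (k + 1) u‖ ≤ B * X u * ‖s - u‖ :=
      (convex_Icc u (u + h)).norm_image_sub_le_of_norm_hasDerivWithin_le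
        (fun x _ => (hΦ (k + 1) x).hasDerivWithinAt)
        (fun x hx => hupper (k + 2) (by omega) x hx) ⟨le_rfl, by linarith⟩ hs
    rw [Real.norm_eq_abs, Real.norm_eq_abs, abs_sub_comm, abs_of_nonneg (sub_nonneg.2 hs.1)] at hdiff
    have h2 := abs_sub_abs_le_abs_sub (Φ (k + 1) u) (Φ (k + 1) s)
    have h3 : B * X u * (s - u) ≤ c / 4 * X u := by
      calc B * X u * (s - u) ≤ B * X u * h := by gcongr; linarith [hs.2]
        _ = h * B * X u := by ring
        _ ≤ _ := by gcongr
    have h5 : c / 4 * X u = c / 2 * X u - c / 4 * X u := by ring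
    linarith
  have hlowv : ∀ s ∈ Set.Icc u v, c / 4 * X u ≤ |Φ (k + 1) s| := fun s hs =>
    hlow s ⟨hs.1, hs.2.trans hv.2⟩
  have hμ : 0 < c / 4 * X u := by positivity
  have hm1 : (1 : ℝ) ≤ m := by exact_mod_cast hm
  have hXm0 : 0 ≤ X u ^ (-(m : ℝ)⁻¹) := by positivity
  have hsum0 : 0 ≤ ∑ k ∈ Finset.range m, Cv k * (c / 4) ^ (-((k : ℝ) + 2)⁻¹) :=
    Finset.sum_nonneg fun k _ => mul_nonneg (hCv k) (by positivity)
  rcases k with _ | k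
  · have h1 := norm_integral_exp_phase_le hv.1 hμ (hΦ 0) (hΦ 1) (cΦ 2) hlowv
    have h2 : ∫ s in u..v, |Φ 2 s| / Φ 1 s ^ 2 ≤ (B * X u / (c / 4 * X u) ^ 2) * (v - u) := by
      have hn : ‖∫ s in u..v, |Φ 2 s| / Φ 1 s ^ 2‖ ≤
          (B * X u / (c / 4 * X u) ^ 2) * |v - u| := by
        apply intervalIntegral.norm_integral_le_of_norm_le_const
        intro s hs
        rw [Set.uIoc_of_le hv.1] at hs
        have hs' : s ∈ Set.Icc u v := ⟨hs.1.le, hs.2⟩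
        rw [norm_div, Real.norm_eq_abs, abs_abs, norm_pow, Real.norm_eq_abs]
        gcongr
        · exact hupper 2 (by omega) s ⟨hs'.1, hs'.2.trans hv.2⟩
        · exact hlowv s hs'
      rw [abs_of_nonneg (sub_nonneg.2 hv.1)] at hn
      exact (le_abs_self _).trans hn
    have h3 : (B * X u / (c / 4 * X u) ^ 2) * (v - u) ≤ 4 / (c * X u) := by
      calc (B * X u / (c / 4 * X u) ^ 2) * (v - u) ≤ (B * X u / (c / 4 * X u) ^ 2) * h := by
            gcongr; linarith [hv.2]
        _ = (h * B) * (X u / (c / 4 * X u) ^ 2) := by ring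
        _ ≤ (c / 4) * (X u / (c / 4 * X u) ^ 2) := by gcongr
        _ = _ := by field_simp
    have h4 : (X u)⁻¹ ≤ X u ^ (-(m : ℝ)⁻¹) := by
      rw [← Real.rpow_neg_one]
      apply Real.rpow_le_rpow_of_exponent_le hX1'
      exact neg_le_neg (inv_le_one_of_one_le₀ hm1)
    calc _ ≤ 2 / (c / 4 * X u) + 4 / (c * X u) := h1.trans (by linarith)
      _ = 12 / c * (X u)⁻¹ := by field_simp; ring
      _ ≤ 12 / c * X u ^ (-(m : ℝ)⁻¹) := by gcongr
      _ ≤ _ := by gcongr; linarith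
  · have h1 := hvdc k Φ hΦ u v (c / 4 * X u) hv.1 hμ hlowv
    have h2 : (c / 4 * X u) ^ (-((k : ℝ) + 2)⁻¹) =
        (c / 4) ^ (-((k : ℝ) + 2)⁻¹) * X u ^ (-((k : ℝ) + 2)⁻¹) :=
      Real.mul_rpow (by positivity) hX0.le
    have h3 : X u ^ (-((k : ℝ) + 2)⁻¹) ≤ X u ^ (-(m : ℝ)⁻¹) := by
      apply Real.rpow_le_rpow_of_exponent_le hX1'
      apply neg_le_neg
      apply inv_anti₀ (by positivity)
      have : k + 2 ≤ m := by omega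
      exact_mod_cast this
    have h4 : Cv k * (c / 4) ^ (-((k : ℝ) + 2)⁻¹) ≤
        ∑ k ∈ Finset.range m, Cv k * (c / 4) ^ (-((k : ℝ) + 2)⁻¹) :=
      Finset.single_le_sum (f := fun k : ℕ => Cv k * (c / 4) ^ (-((k : ℝ) + 2)⁻¹))
        (fun k _ => mul_nonneg (hCv k) (by positivity)) (Finset.mem_range.2 (by omega))
    have h5 : 0 ≤ Cv k * (c / 4) ^ (-((k : ℝ) + 2)⁻¹) := mul_nonneg (hCv k) (by positivity)
    have h6 : 0 ≤ 12 / c := by positivity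
    calc _ ≤ Cv k * (c / 4 * X u) ^ (-((k : ℝ) + 2)⁻¹) := h1
      _ = Cv k * (c / 4) ^ (-((k : ℝ) + 2)⁻¹) * X u ^ (-((k : ℝ) + 2)⁻¹) := by rw [h2]; ring
      _ ≤ Cv k * (c / 4) ^ (-((k : ℝ) + 2)⁻¹) * X u ^ (-(m : ℝ)⁻¹) := by gcongr
      _ ≤ _ := by gcongr; linarith

/-- Uniform decay for phases `e^{βs} - ∑ ηᵢ Fᵢ(e^{-s})` with functions `Fᵢ` vanishing to distinct
positive orders at the origin. -/
theorem exists_oscillatory_bound {n : ℕ} {F : Fin n → ℝ → ℝ} (hF : ∀ i, ContDiff ℝ (⊤ : ℕ∞) (F i))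
    {a : Fin n → ℕ} (ha : Function.Injective a) (ha1 : ∀ i, 1 ≤ a i)
    (hvan : ∀ i, ∀ k < a i, iteratedDeriv k (F i) 0 = 0)
    (hne : ∀ i, iteratedDeriv (a i) (F i) 0 ≠ 0) {β : ℝ} (hβ : 0 < β) :
    ∃ h C : ℝ, 0 < h ∧ 0 ≤ C ∧ ∀ (η : Fin n → ℝ) (u : ℝ), 0 ≤ u → ∀ v ∈ Set.Icc u (u + h),
      ‖∫ s in u..v, Complex.exp (Complex.I *
        ((Real.exp (β * s) - ∑ i, η i * F i (Real.exp (-s)) : ℝ) : ℂ))‖ ≤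
          C * Real.exp (-(β / (n + 1)) * u) := by
  choose K hK hbd using fun i => exists_eulerIter_bound (hF i) (hvan i) (n + 2)
  set b : Fin n → ℝ := fun i => iteratedDeriv (a i) (F i) 0 / (a i).factorial with hb
  have hb0 : ∀ i, b i ≠ 0 := fun i => div_ne_zero (hne i) (by exact_mod_cast (a i).factorial_ne_zero)
  let e : Fin (n + 1) → ℝ := Fin.cons β fun i => -(a i : ℝ)
  have ha1' : ∀ i, (0 : ℝ) < a i := fun i => by exact_mod_cast ha1 i
  have he : Function.Injective e := by
    rw [Fin.cons_injective_iff]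
    refine ⟨?_, fun i j hij => ha (by simpa using hij)⟩
    rintro ⟨i, hi⟩
    have := ha1' i
    simp only at hi
    linarith
  have he0 : ∀ i, e i ≠ 0 := fun i => by
    refine Fin.cases ?_ (fun i => ?_) i
    · exact hβ.ne'
    · simpa [e] using (Nat.one_le_iff_ne_zero.1 (ha1 i))
  set Kt := ∑ i, K i / |b i| with hKt
  have hKnn : ∀ i, 0 ≤ K i / |b i| := fun i => div_nonneg (hK i) (abs_nonneg _)
  have hKt0 : 0 ≤ Kt := Finset.sum_nonneg fun i _ => hKnn i
  obtain ⟨u₀, h, C, hh, hC, hosc⟩ :=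
    exists_oscillatory_bound_of_perturbation (Nat.succ_pos n) he he0 Kt hKt0
  refine ⟨h, C + h * Real.exp (β / (n + 1) * |u₀|), hh, by positivity, ?_⟩
  intro η u hu v hv
  let y : Fin (n + 1) → ℝ := Fin.cons 1 fun i => -(η i * b i)
  let Φ : ℕ → ℝ → ℝ := fun k s => β ^ k * Real.exp (β * s) -
    ∑ i, η i * ((-1) ^ k * eulerIter (F i) k (Real.exp (-s)))
  have hΦ0 : ∀ s, Φ 0 s = Real.exp (β * s) - ∑ i, η i * F i (Real.exp (-s)) := fun s => by
    simp [Φ, eulerIter]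
  simp_rw [← hΦ0]
  have hn1 : (0 : ℝ) < n + 1 := by positivity
  rcases le_total u u₀ with hlt | hge
  · refine (norm_integral_exp_phase_le_length hv.1).trans ?_
    have h1 : 1 ≤ Real.exp (β / (n + 1) * |u₀|) * Real.exp (-(β / (n + 1)) * u) := by
      rw [← Real.exp_add]
      apply Real.one_le_exp
      have : 0 ≤ β / (n + 1) * (|u₀| - u) :=
        mul_nonneg (by positivity) (by linarith [le_abs_self u₀])
      linarith
    calc v - u ≤ h * 1 := by linarith [hv.2]
      _ ≤ h * (Real.exp (β / (n + 1) * |u₀|) * Real.exp (-(β / (n + 1)) * u)) := by gcongr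
      _ = h * Real.exp (β / (n + 1) * |u₀|) * Real.exp (-(β / (n + 1)) * u) := by ring
      _ ≤ _ := by gcongr; linarith
  have hderiv : ∀ k u, HasDerivAt (Φ k) (Φ (k + 1) u) u := by
    intro k u
    have h1 : HasDerivAt (fun s => β ^ k * Real.exp (β * s)) (β ^ (k + 1) * Real.exp (β * u)) u := by
      refine ((((hasDerivAt_id u).const_mul β).exp).const_mul (β ^ k)).congr_deriv ?_
      simp only [id]
      ring
    exact h1.sub (HasDerivAt.fun_sum fun i _ =>
      (hasDerivAt_eulerIter_exp (hF i) k u).const_mul (η i))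
  have hexp : ∀ (i : Fin n) (s : ℝ), Real.exp (-(a i : ℝ) * s) = Real.exp (-s) ^ a i := fun i s => by
    rw [← Real.exp_nat_mul]
    ring_nf
  have happ : ∀ s, 0 ≤ s → ∀ k ≤ n + 1 + 1, |Φ k s - ∑ i, e i ^ k * (y i * Real.exp (e i * s))| ≤
        Kt * Real.exp (-s) * ∑ i, |y i * Real.exp (e i * s)| := by
    intro s hs k hk
    have ht : Real.exp (-s) ∈ Set.Icc (0 : ℝ) 1 :=
      ⟨(Real.exp_pos _).le, Real.exp_le_one_iff.2 (by linarith)⟩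
    have h1 : Φ k s - ∑ i, e i ^ k * (y i * Real.exp (e i * s)) =
        ∑ i, -(η i * (-1) ^ k) * (eulerIter (F i) k (Real.exp (-s)) -
          (a i : ℝ) ^ k * b i * Real.exp (-s) ^ a i) := by
      rw [Fin.sum_univ_succ]
      simp only [Φ, e, y, Fin.cons_zero, Fin.cons_succ, one_mul, hexp]
      rw [sub_sub, add_left_comm, ← sub_sub, sub_self, zero_sub, ← Finset.sum_add_distrib,
        ← Finset.sum_neg_distrib]
      refine Finset.sum_congr rfl fun i _ => ?_
      rw [neg_pow (a i : ℝ)]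
      ring
    rw [h1]
    refine (Finset.abs_sum_le_sum_abs _ _).trans ?_
    have hXle : ∀ i : Fin n, |η i| * |b i| * Real.exp (-s) ^ a i ≤
        ∑ i, |y i * Real.exp (e i * s)| := by
      intro i
      refine le_trans (le_of_eq ?_) (Finset.single_le_sum
        (f := fun i => |y i * Real.exp (e i * s)|) (fun _ _ => abs_nonneg _)
        (Finset.mem_univ i.succ))
      simp only [y, e, Fin.cons_succ, hexp]
      rw [abs_mul, abs_neg, abs_mul, abs_of_nonneg (pow_nonneg ht.1 _)]
    rw [hKt, Finset.sum_mul, Finset.sum_mul]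
    refine Finset.sum_le_sum fun i _ => ?_
    have hbi : 0 < |b i| := abs_pos.2 (hb0 i)
    rw [abs_mul, abs_neg, abs_mul, abs_pow, abs_neg, abs_one, one_pow, mul_one]
    calc _ ≤ |η i| * (K i * Real.exp (-s) ^ (a i + 1)) := by
          gcongr
          exact hbd i k hk _ ht
      _ = K i / |b i| * Real.exp (-s) * (|η i| * |b i| * Real.exp (-s) ^ a i) := by
          field_simp
          ring
      _ ≤ _ := by
          gcongr
          · exact mul_nonneg (hKnn i) ht.1
          · exact hXle i
  have hXlow : Real.exp (β * u) ≤ ∑ i, |y i * Real.exp (e i * u)| := by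
    refine le_trans (le_of_eq ?_) (Finset.single_le_sum
      (f := fun i => |y i * Real.exp (e i * u)|) (fun _ _ => abs_nonneg _)
      (Finset.mem_univ 0))
    simp [y, e]
  have hX1 : 1 ≤ ∑ i, |y i * Real.exp (e i * u)| :=
    (Real.one_le_exp (by positivity)).trans hXlow
  refine (hosc Φ y hderiv happ u hu hge hX1 v hv).trans ?_
  have hdec : (∑ i, |y i * Real.exp (e i * u)|) ^ (-((n + 1 : ℕ) : ℝ)⁻¹) ≤
      Real.exp (-(β / (n + 1)) * u) := by
    calc _ ≤ Real.exp (β * u) ^ (-((n + 1 : ℕ) : ℝ)⁻¹) :=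
          Real.rpow_le_rpow_of_nonpos (Real.exp_pos _) hXlow
            (neg_nonpos.2 (by positivity))
      _ = _ := by
          rw [← Real.exp_mul]
          congr 1
          push_cast
          field_simp
  calc _ ≤ C * Real.exp (-(β / (n + 1)) * u) := by gcongr
    _ ≤ _ := by gcongr; linarith [mul_pos hh (Real.exp_pos (β / (n + 1) * |u₀|))]

/-- A family of vectors adapted to the orders of vanishing of a sequence of functionals. -/
theorem exists_adapted_family {E : Type*} [AddCommGroup E] [Module ℝ E] (ℓ : ℕ → E →ₗ[ℝ] ℝ)
    (n : ℕ) (W : Submodule ℝ E) [FiniteDimensional ℝ W] (hW : Module.finrank ℝ W = n)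
    (hsep : ∀ x ∈ W, (∀ k, ℓ k x = 0) → x = 0) :
    ∃ (a : Fin n → ℕ) (w : Fin n → E), Function.Injective a ∧ (∀ i, w i ∈ W) ∧
      (∀ i, ∀ k < a i, ℓ k (w i) = 0) ∧ (∀ i, ℓ (a i) (w i) ≠ 0) ∧
      ∀ x ∈ W, ∃ c : Fin n → ℝ, x = ∑ i, c i • w i := by
  classical
  induction n generalizing W with
  | zero =>
    refine ⟨Fin.elim0, Fin.elim0, fun i => i.elim0, fun i => i.elim0, fun i => i.elim0,
      fun i => i.elim0, fun x hx => ⟨Fin.elim0, ?_⟩⟩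
    have : W = ⊥ := Submodule.finrank_eq_zero.1 hW
    subst this
    simpa using hx
  | succ n ih =>
    have hex : ∃ k, ∃ x ∈ W, ℓ k x ≠ 0 := by
      by_contra! hcon
      have : W = ⊥ := (Submodule.eq_bot_iff _).2 fun x hx => hsep x hx fun k => hcon k x hx
      rw [this, finrank_bot] at hW
      omega
    set k := Nat.find hex with hk
    obtain ⟨w₀, hw₀, hne⟩ := Nat.find_spec hex
    rw [← hk] at hne
    have hmin : ∀ j < k, ∀ x ∈ W, ℓ j x = 0 := fun j hj x hx => by
      have := Nat.find_min hex hj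
      push Not at this
      exact this x hx
    let W' : Submodule ℝ E := W ⊓ LinearMap.ker (ℓ k)
    have hle : W' ≤ W := inf_le_left
    have : FiniteDimensional ℝ W' := Submodule.finiteDimensional_of_le hle
    have hW' : Module.finrank ℝ W' = n := by
      have h1 := LinearMap.finrank_range_add_finrank_ker ((ℓ k).domRestrict W)
      have h2 : LinearMap.range ((ℓ k).domRestrict W) = ⊤ := by
        apply LinearMap.range_eq_top.2
        intro r
        exact ⟨(r / ℓ k w₀) • ⟨w₀, hw₀⟩, by simp [LinearMap.domRestrict_apply, hne]⟩
      have h3 : Module.finrank ℝ (LinearMap.ker ((ℓ k).domRestrict W)) = Module.finrank ℝ W' := by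
        have h4 : W' = (LinearMap.ker ((ℓ k).domRestrict W)).map W.subtype := by
          ext x
          simp [W', LinearMap.domRestrict_apply, and_comm]
        rw [h4]
        exact (LinearEquiv.finrank_eq
          (Submodule.equivMapOfInjective W.subtype W.injective_subtype _))
      rw [h2, finrank_top, Module.finrank_self, hW, h3] at h1
      omega
    obtain ⟨a, w, ha, hwW, hlow, hnz, hspan⟩ := ih W' hW' fun x hx => hsep x (hle hx)
    refine ⟨Fin.cons k a, Fin.cons w₀ w, ?_, ?_, ?_, ?_, ?_⟩
    · rw [Fin.cons_injective_iff]
      refine ⟨?_, ha⟩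
      rintro ⟨i, hi⟩
      exact hnz i (by rw [hi]; exact (hwW i).2)
    · exact fun i => Fin.cases hw₀ (fun i => hle (hwW i)) i
    · exact fun i => Fin.cases (fun j hj => hmin j hj w₀ hw₀) (fun i => hlow i) i
    · exact fun i => Fin.cases hne (fun i => hnz i) i
    · intro x hx
      have hx' : x - (ℓ k x / ℓ k w₀) • w₀ ∈ W' :=
        ⟨W.sub_mem hx (W.smul_mem _ hw₀), by simp [hne]⟩
      obtain ⟨c, hc⟩ := hspan _ hx'
      refine ⟨Fin.cons (ℓ k x / ℓ k w₀) c, ?_⟩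
      rw [Fin.sum_univ_succ]
      simp only [Fin.cons_zero, Fin.cons_succ, ← hc]
      abel

theorem iteratedDeriv_inner_const {d : ℕ} {γ : ℝ → EuclideanSpace ℝ (Fin d)}
    (hγ : ContDiff ℝ (⊤ : ℕ∞) γ) (w : EuclideanSpace ℝ (Fin d)) (k : ℕ) :
    iteratedDeriv k (fun t => inner ℝ w (γ t)) = fun t => inner ℝ w (iteratedDeriv k γ t) := by
  have hsm : ∀ k, ContDiff ℝ (⊤ : ℕ∞) (iteratedDeriv k γ) := fun k => by
    induction k with
    | zero => simpa using hγ
    | succ k ih => rw [iteratedDeriv_succ]; exact ((contDiff_infty_iff_deriv (𝕜 := ℝ)).1 ih).2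
  induction k with
  | zero => simp
  | succ k ih =>
    rw [iteratedDeriv_succ, ih, iteratedDeriv_succ]
    funext t
    have h : HasDerivAt (iteratedDeriv k γ) (deriv (iteratedDeriv k γ) t) t :=
      ((hsm k).differentiable (by simp)).differentiableAt.hasDerivAt
    exact ((innerSL ℝ w).hasFDerivAt.comp_hasDerivAt t h).deriv

theorem IsWellCurved.comp_neg {d : ℕ} {γ : ℝ → EuclideanSpace ℝ (Fin d)} (hγ : IsWellCurved d γ) :
    IsWellCurved d fun t => γ (-t) := by
  refine ⟨hγ.1.comp contDiff_neg, by simpa using hγ.2.1, ?_⟩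
  rw [eq_top_iff, ← hγ.2.2, Submodule.span_le]
  rintro _ ⟨k, rfl⟩
  have h : iteratedDeriv (k + 1) γ 0 =
      (-1 : ℝ) ^ (k + 1) • iteratedDeriv (k + 1) (fun t => γ (-t)) 0 := by
    rw [iteratedDeriv_comp_neg, smul_smul, ← mul_pow]
    simp
  simp only [h]
  exact Submodule.smul_mem _ _ (Submodule.subset_span ⟨k, rfl⟩)

/-- Uniform decay of the dyadic Fourier multipliers of a well-curved curve. -/
theorem IsWellCurved.exists_oscillatory_bound {d : ℕ} {γ : ℝ → EuclideanSpace ℝ (Fin d)}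
    (hγ : IsWellCurved d γ) {β : ℝ} (hβ : 0 < β) :
    ∃ h C : ℝ, 0 < h ∧ 0 ≤ C ∧ ∀ (ξ : EuclideanSpace ℝ (Fin d)) (u : ℝ), 0 ≤ u →
      ∀ v ∈ Set.Icc u (u + h), ‖∫ s in u..v, Complex.exp (Complex.I *
        ((Real.exp (β * s) - inner ℝ ξ (γ (Real.exp (-s))) : ℝ) : ℂ))‖ ≤
          C * Real.exp (-(β / (d + 1)) * u) := by
  let ℓ : ℕ → EuclideanSpace ℝ (Fin d) →ₗ[ℝ] ℝ := fun k =>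
    (innerSL ℝ (iteratedDeriv k γ 0)).toLinearMap
  have hℓ : ∀ k x, ℓ k x = iteratedDeriv k (fun t => inner ℝ x (γ t)) 0 := fun k x => by
    rw [iteratedDeriv_inner_const hγ.1]
    exact real_inner_comm x (iteratedDeriv k γ 0)
  obtain ⟨a, w, ha, -, hlow, hnz, hspan⟩ := exists_adapted_family ℓ d ⊤ (by simp) fun x _ hx => by
    have h1 : ∀ y ∈ Submodule.span ℝ (Set.range fun k : ℕ => iteratedDeriv (k + 1) γ 0),
        inner ℝ y x = 0 := by
      intro y hy
      induction hy using Submodule.span_induction with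
      | mem y hy => obtain ⟨k, rfl⟩ := hy; exact hx (k + 1)
      | zero => simp
      | add y z _ _ hy hz => rw [inner_add_left, hy, hz, add_zero]
      | smul r y _ hy => rw [real_inner_smul_left, hy, mul_zero]
    rw [hγ.2.2] at h1
    exact inner_self_eq_zero.1 (h1 x trivial)
  have ha1 : ∀ i, 1 ≤ a i := by
    intro i
    by_contra! h0
    have h0' : a i = 0 := by omega
    apply hnz i
    rw [h0', hℓ]
    simp [hγ.2.1]
  simp_rw [hℓ] at hlow hnz
  obtain ⟨h, C, hh, hC, hosc⟩ := _root_.exists_oscillatory_bound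
    (F := fun i t => inner ℝ (w i) (γ t))
    (fun i => contDiff_const.inner ℝ hγ.1) ha ha1 hlow hnz hβ
  refine ⟨h, C, hh, hC, fun ξ u hu v hv => ?_⟩
  obtain ⟨η, hη⟩ := hspan ξ trivial
  have := hosc η u hu v hv
  simpa only [hη, sum_inner, real_inner_smul_left] using this

/-- Decay of the oscillatory integrals with exponential amplitude. -/
theorem norm_integral_exp_amplitude_le {φ : ℝ → ℝ} (hφ : Continuous φ) {α u h M : ℝ}
    (hα : 0 ≤ α) (hh : 0 ≤ h)
    (hM : ∀ v ∈ Set.Icc u (u + h), ‖∫ s in u..v, Complex.exp (Complex.I * (φ s : ℂ))‖ ≤ M) :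
    ‖∫ s in u..(u + h), (Real.exp (α * s) : ℂ) * Complex.exp (Complex.I * (φ s : ℂ))‖ ≤
      2 * M * Real.exp (α * (u + h)) := by
  have hM0 : 0 ≤ M := (norm_nonneg _).trans (hM u ⟨le_rfl, by linarith⟩)
  have huh : u ≤ u + h := by linarith
  have hE : Continuous fun s => Complex.exp (Complex.I * (φ s : ℂ)) := by fun_prop
  let G : ℝ → ℂ := fun v => ∫ s in u..v, Complex.exp (Complex.I * (φ s : ℂ))
  have hG : ∀ v, HasDerivAt G (Complex.exp (Complex.I * (φ v : ℂ))) v := fun v =>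
    intervalIntegral.integral_hasDerivAt_right (hE.intervalIntegrable _ _)
      (hE.stronglyMeasurableAtFilter _ _) hE.continuousAt
  have hGc : Continuous G := continuous_iff_continuousAt.2 fun v => (hG v).continuousAt
  have hA : ∀ v, HasDerivAt (fun s : ℝ => (Real.exp (α * s) : ℂ))
      ((α * Real.exp (α * v) : ℝ) : ℂ) v := fun v => by
    have := ((hasDerivAt_id v).const_mul α).exp
    refine HasDerivAt.ofReal_comp (this.congr_deriv ?_)
    simp only [id]
    ring
  have hAr : ∀ v, HasDerivAt (fun s : ℝ => Real.exp (α * s)) (α * Real.exp (α * v)) v := fun v => by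
    refine (((hasDerivAt_id v).const_mul α).exp).congr_deriv ?_
    simp only [id]
    ring
  have hA' : Continuous fun v : ℝ => ((α * Real.exp (α * v) : ℝ) : ℂ) := by fun_prop
  rw [intervalIntegral.integral_mul_deriv_eq_deriv_mul (fun v _ => hA v) (fun v _ => hG v)
    (hA'.intervalIntegrable _ _) (hE.intervalIntegrable _ _)]
  have hGu : G u = 0 := intervalIntegral.integral_same
  rw [hGu, mul_zero, sub_zero]
  have h1 : ‖(Real.exp (α * (u + h)) : ℂ) * G (u + h)‖ ≤ Real.exp (α * (u + h)) * M := by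
    rw [norm_mul, Complex.norm_real, Real.norm_eq_abs, Real.abs_exp]
    gcongr
    exact hM _ ⟨huh, le_rfl⟩
  have h2 : ‖∫ s in u..(u + h), ((α * Real.exp (α * s) : ℝ) : ℂ) * G s‖ ≤
      Real.exp (α * (u + h)) * M := by
    have h3 : ‖∫ s in u..(u + h), ((α * Real.exp (α * s) : ℝ) : ℂ) * G s‖ ≤
        ∫ s in u..(u + h), (α * Real.exp (α * s)) * M := by
      apply intervalIntegral.norm_integral_le_of_norm_le huh
      · refine Filter.Eventually.of_forall fun s hs => ?_
        rw [norm_mul, Complex.norm_real, Real.norm_eq_abs, abs_of_nonneg (by positivity)]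
        gcongr
        exact hM s ⟨hs.1.le, hs.2⟩
      · exact Continuous.intervalIntegrable (by fun_prop) _ _
    refine h3.trans ?_
    rw [intervalIntegral.integral_mul_const,
      intervalIntegral.integral_eq_sub_of_hasDerivAt (fun v _ => hAr v)
        (Continuous.intervalIntegrable (by fun_prop) _ _)]
    gcongr
    linarith [Real.exp_pos (α * u)]
  calc _ ≤ Real.exp (α * (u + h)) * M + Real.exp (α * (u + h)) * M :=
        (norm_sub_le _ _).trans (add_le_add h1 h2)
    _ = _ := by ring

theorem lintegral_Ioi_rpow_mul_indicator_lt_le {r c y : ℝ} (hr : 0 < r) (hc : 0 < c) (hy : 0 ≤ y) :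
    ∫⁻ t in Set.Ioi (0 : ℝ), {t | c * t < y}.indicator (fun t => ENNReal.ofReal (t ^ (r - 1))) t ≤
      ENNReal.ofReal (y ^ r * (c ^ (-r) / r)) := by
  have hyc : 0 ≤ y / c := by positivity
  have hms : MeasurableSet {t : ℝ | c * t < y} :=
    measurableSet_lt (by fun_prop) measurable_const
  rw [lintegral_indicator hms, Measure.restrict_restrict hms]
  have hsub : {t : ℝ | c * t < y} ∩ Set.Ioi 0 ⊆ Set.Ioc 0 (y / c) := fun t ht =>
    ⟨ht.2, by rw [le_div_iff₀ hc]; linarith [show c * t < y from ht.1]⟩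
  refine (lintegral_mono_set hsub).trans ?_
  have hint : IntervalIntegrable (fun t : ℝ => t ^ (r - 1)) volume 0 (y / c) :=
    intervalIntegral.intervalIntegrable_rpow' (by linarith)
  rw [← ofReal_integral_eq_lintegral_ofReal
    ((intervalIntegrable_iff_integrableOn_Ioc_of_le hyc).1 hint)
    ((ae_restrict_iff' measurableSet_Ioc).2 (Eventually.of_forall fun t ht =>
      Real.rpow_nonneg ht.1.le _)), ← intervalIntegral.integral_of_le hyc,
    integral_rpow (Or.inl (by linarith))]
  apply ENNReal.ofReal_le_ofReal
  rw [sub_add_cancel, Real.zero_rpow hr.ne', sub_zero, Real.div_rpow hy hc.le, Real.rpow_neg hc.le]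
  apply le_of_eq
  field_simp

theorem lintegral_Ioi_rpow_mul_indicator_le_le {s c y : ℝ} (hs : 0 < s) (hc : 0 < c) (hy : 0 < y) :
    ∫⁻ t in Set.Ioi (0 : ℝ), {t | y ≤ c * t}.indicator (fun t => ENNReal.ofReal (t ^ (-s - 1))) t ≤
      ENNReal.ofReal (y ^ (-s) * (c ^ s / s)) := by
  have hyc : 0 < y / c := by positivity
  have hms : MeasurableSet {t : ℝ | y ≤ c * t} :=
    measurableSet_le measurable_const (by fun_prop)
  rw [lintegral_indicator hms, Measure.restrict_restrict hms]
  have hsub : {t : ℝ | y ≤ c * t} ∩ Set.Ioi 0 ⊆ Set.Ici (y / c) := fun t ht => by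
    rw [Set.mem_Ici, div_le_iff₀ hc]
    linarith [show y ≤ c * t from ht.1]
  refine (lintegral_mono_set hsub).trans ?_
  rw [setLIntegral_congr Ioi_ae_eq_Ici.symm, ← ofReal_integral_eq_lintegral_ofReal
    (integrableOn_Ioi_rpow_of_lt (by linarith) hyc)
    ((ae_restrict_iff' measurableSet_Ioi).2 (Eventually.of_forall fun t ht =>
      Real.rpow_nonneg (hyc.le.trans (le_of_lt ht)) _)),
    integral_Ioi_rpow_of_lt (by linarith) hyc]
  apply ENNReal.ofReal_le_ofReal
  rw [sub_add_cancel, Real.div_rpow hy.le hc.le, Real.rpow_neg hc.le]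
  apply le_of_eq
  field_simp

section Tonelli

variable {X : Type*} [MeasurableSpace X] {μ : Measure X} [SFinite μ]

theorem lintegral_rpow_mul_lintegral_indicator_lt_le {g : X → ℝ} (hg : Measurable g)
    (hg0 : ∀ x, 0 ≤ g x) {w : X → ℝ≥0∞} (hw : Measurable w) {r c : ℝ} (hr : 0 < r) (hc : 0 < c) :
    ∫⁻ t in Set.Ioi (0 : ℝ), ENNReal.ofReal (t ^ (r - 1)) *
        ∫⁻ x, {x | c * t < g x}.indicator w x ∂μ ≤
      ∫⁻ x, w x * ENNReal.ofReal (g x ^ r * (c ^ (-r) / r)) ∂μ := by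
  have hS : MeasurableSet {q : ℝ × X | c * q.1 < g q.2} :=
    measurableSet_lt (by fun_prop) (hg.comp measurable_snd)
  have hSt : ∀ t : ℝ, MeasurableSet {x | c * t < g x} := fun t =>
    measurableSet_lt measurable_const hg
  calc _ = ∫⁻ t in Set.Ioi (0 : ℝ), ∫⁻ x, {q : ℝ × X | c * q.1 < g q.2}.indicator
        (fun q => w q.2 * ENNReal.ofReal (q.1 ^ (r - 1))) (t, x) ∂μ := by
        refine lintegral_congr fun t => ?_
        rw [← lintegral_const_mul _ (hw.indicator (hSt t))]
        refine lintegral_congr fun x => ?_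
        by_cases h : c * t < g x <;> simp [Set.indicator, h, mul_comm]
    _ = ∫⁻ x, (∫⁻ t in Set.Ioi (0 : ℝ), {q : ℝ × X | c * q.1 < g q.2}.indicator
        (fun q => w q.2 * ENNReal.ofReal (q.1 ^ (r - 1))) (t, x)) ∂μ := by
        refine lintegral_lintegral_swap (Measurable.aemeasurable ?_)
        refine Measurable.indicator ?_ hS
        fun_prop
    _ ≤ _ := by
        refine lintegral_mono fun x => ?_
        have h1 : ∀ t : ℝ, {q : ℝ × X | c * q.1 < g q.2}.indicator
            (fun q => w q.2 * ENNReal.ofReal (q.1 ^ (r - 1))) (t, x) =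
            w x * {t | c * t < g x}.indicator (fun t => ENNReal.ofReal (t ^ (r - 1))) t := by
          intro t
          by_cases h : c * t < g x <;> simp [Set.indicator, h]
        simp only [h1]
        rw [lintegral_const_mul _ (Measurable.indicator (by fun_prop)
          (measurableSet_lt (by fun_prop) measurable_const))]
        gcongr
        exact lintegral_Ioi_rpow_mul_indicator_lt_le hr hc (hg0 x)

theorem lintegral_rpow_mul_lintegral_indicator_le_le {g : X → ℝ} (hg : Measurable g)
    (hg0 : ∀ x, 0 ≤ g x) {w : X → ℝ≥0∞} (hw : Measurable w) (hgw : ∀ x, g x = 0 → w x = 0)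
    {s c : ℝ} (hs : 0 < s) (hc : 0 < c) :
    ∫⁻ t in Set.Ioi (0 : ℝ), ENNReal.ofReal (t ^ (-s - 1)) *
        ∫⁻ x, {x | g x ≤ c * t}.indicator w x ∂μ ≤
      ∫⁻ x, w x * ENNReal.ofReal (g x ^ (-s) * (c ^ s / s)) ∂μ := by
  have hS : MeasurableSet {q : ℝ × X | g q.2 ≤ c * q.1} :=
    measurableSet_le (hg.comp measurable_snd) (by fun_prop)
  have hSt : ∀ t : ℝ, MeasurableSet {x | g x ≤ c * t} := fun t =>
    measurableSet_le hg measurable_const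
  calc _ = ∫⁻ t in Set.Ioi (0 : ℝ), ∫⁻ x, {q : ℝ × X | g q.2 ≤ c * q.1}.indicator
        (fun q => w q.2 * ENNReal.ofReal (q.1 ^ (-s - 1))) (t, x) ∂μ := by
        refine lintegral_congr fun t => ?_
        rw [← lintegral_const_mul _ (hw.indicator (hSt t))]
        refine lintegral_congr fun x => ?_
        by_cases h : g x ≤ c * t <;> simp [Set.indicator, h, mul_comm]
    _ = ∫⁻ x, (∫⁻ t in Set.Ioi (0 : ℝ), {q : ℝ × X | g q.2 ≤ c * q.1}.indicator
        (fun q => w q.2 * ENNReal.ofReal (q.1 ^ (-s - 1))) (t, x)) ∂μ := by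
        refine lintegral_lintegral_swap (Measurable.aemeasurable ?_)
        refine Measurable.indicator ?_ hS
        fun_prop
    _ ≤ _ := by
        refine lintegral_mono fun x => ?_
        have h1 : ∀ t : ℝ, {q : ℝ × X | g q.2 ≤ c * q.1}.indicator
            (fun q => w q.2 * ENNReal.ofReal (q.1 ^ (-s - 1))) (t, x) =
            w x * {t | g x ≤ c * t}.indicator (fun t => ENNReal.ofReal (t ^ (-s - 1))) t := by
          intro t
          by_cases h : g x ≤ c * t <;> simp [Set.indicator, h]
        simp only [h1]
        rw [lintegral_const_mul _ (Measurable.indicator (by fun_prop)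
          (measurableSet_le measurable_const (by fun_prop)))]
        rcases (hg0 x).eq_or_lt with h0 | h0
        · simp [hgw x h0.symm]
        · gcongr
          exact lintegral_Ioi_rpow_mul_indicator_le_le hs hc h0

end Tonelli

section Interpolation

variable {X : Type*} [MeasurableSpace X]

/-- Bounded integrable measurable functions, the domain on which interpolation is carried out. -/
structure IsBoundedIntegrable (μ : Measure X) (f : X → ℂ) : Prop where
  measurable : Measurable f
  bounded : ∃ M, ∀ x, ‖f x‖ ≤ M
  integrable : Integrable f μ

/-- An additive operator of strong types `(1, 1)` and `(∞, ∞)` with constant `A₁` and of strong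
type `(2, 2)` with constant `A₂`. -/
structure HasStrongTypes (μ : Measure X) (S : (X → ℂ) → X → ℂ) (A₁ A₂ : ℝ) : Prop where
  measurable : ∀ f, IsBoundedIntegrable μ f → Measurable (S f)
  add : ∀ f g, IsBoundedIntegrable μ f → IsBoundedIntegrable μ g → ∀ x,
    S (fun y => f y + g y) x = S f x + S g x
  norm_le : ∀ f M, IsBoundedIntegrable μ f → (∀ x, ‖f x‖ ≤ M) → ∀ x, ‖S f x‖ ≤ A₁ * M
  lintegral_le : ∀ f, IsBoundedIntegrable μ f →
    ∫⁻ x, ENNReal.ofReal ‖S f x‖ ∂μ ≤ ENNReal.ofReal A₁ * ∫⁻ x, ENNReal.ofReal ‖f x‖ ∂μ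
  lintegral_sq_le : ∀ f, IsBoundedIntegrable μ f →
    ∫⁻ x, ENNReal.ofReal (‖S f x‖ ^ 2) ∂μ ≤
      ENNReal.ofReal (A₂ ^ 2) * ∫⁻ x, ENNReal.ofReal (‖f x‖ ^ 2) ∂μ

variable {μ : Measure X}

theorem IsBoundedIntegrable.indicator {f : X → ℂ} (hf : IsBoundedIntegrable μ f) {s : Set X}
    (hs : MeasurableSet s) : IsBoundedIntegrable μ (s.indicator f) where
  measurable := hf.measurable.indicator hs
  bounded := by
    obtain ⟨M, hM⟩ := hf.bounded
    exact ⟨M, fun x => (norm_indicator_le_norm_self f x).trans (hM x)⟩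
  integrable := hf.integrable.indicator hs

theorem measure_lt_le_lintegral_pow {u : X → ℝ} (hu : Measurable u) {s : ℝ}
    (hs : 0 < s) (k : ℕ) :
    μ {x | s < u x} ≤ ENNReal.ofReal ((s ^ k)⁻¹) * ∫⁻ x, ENNReal.ofReal (u x ^ k) ∂μ := by
  have h1 : μ {x | s < u x} ≤ μ {x | ENNReal.ofReal (s ^ k) ≤ ENNReal.ofReal (u x ^ k)} := by
    refine measure_mono fun x hx => ENNReal.ofReal_le_ofReal ?_
    have hx' : s < u x := hx
    gcongr
  have h2 := mul_meas_ge_le_lintegral (μ := μ) (f := fun x => ENNReal.ofReal (u x ^ k))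
    (by fun_prop) (ENNReal.ofReal (s ^ k))
  rw [ENNReal.ofReal_inv_of_pos (by positivity)]
  refine h1.trans ?_
  rw [← ENNReal.div_eq_inv_mul]
  exact (ENNReal.le_div_iff_mul_le (Or.inl (by simpa using by positivity))
    (Or.inl ENNReal.ofReal_ne_top)).2 (by rwa [mul_comm])

omit [MeasurableSpace X] in
theorem ofReal_norm_indicator_pow {f : X → ℂ} (s : Set X) {k : ℕ} (hk : k ≠ 0) (x : X) :
    ENNReal.ofReal (‖s.indicator f x‖ ^ k) =
      s.indicator (fun x => ENNReal.ofReal (‖f x‖ ^ k)) x := by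
  by_cases h : x ∈ s <;> simp [h, hk]

theorem ofReal_pow_mul_ofReal_rpow {y C r p : ℝ} {k : ℕ} (hy : 0 ≤ y) (hp : p ≠ 0)
    (h : k + r = p) :
    ENNReal.ofReal (y ^ k) * ENNReal.ofReal (y ^ r * C) =
      ENNReal.ofReal (y ^ p) * ENNReal.ofReal C := by
  rw [ENNReal.ofReal_mul (Real.rpow_nonneg hy _), ← mul_assoc,
    ← ENNReal.ofReal_mul (by positivity), ← h, Real.rpow_add' hy (by rwa [h]), Real.rpow_natCast]

variable [SFinite μ] {S : (X → ℂ) → X → ℂ} {A₁ A₂ : ℝ}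

theorem HasStrongTypes.lintegral_rpow_le_of_two_lt (hS : HasStrongTypes μ S A₁ A₂) (h₁ : 0 < A₁)
    {p : ℝ} (hp : 2 < p) {f : X → ℂ} (hf : IsBoundedIntegrable μ f) :
    ∫⁻ x, ENNReal.ofReal (‖S f x‖ ^ p) ∂μ ≤
      ENNReal.ofReal (4 * p / (p - 2) * (A₂ ^ 2 * (2 * A₁) ^ (p - 2))) *
        ∫⁻ x, ENNReal.ofReal (‖f x‖ ^ p) ∂μ := by
  set c : ℝ := (2 * A₁)⁻¹ with hc
  have hc0 : 0 < c := by positivity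
  have hfm := hf.measurable
  rw [lintegral_rpow_eq_lintegral_meas_lt_mul μ (Eventually.of_forall fun x => norm_nonneg _)
    (hS.measurable f hf).norm.aemeasurable (by linarith)]
  have key : ∀ t ∈ Set.Ioi (0 : ℝ), μ {x | t < ‖S f x‖} * ENNReal.ofReal (t ^ (p - 1)) ≤
      ENNReal.ofReal (4 * A₂ ^ 2) * (ENNReal.ofReal (t ^ (p - 2 - 1)) *
        ∫⁻ x, {x | c * t < ‖f x‖}.indicator (fun x => ENNReal.ofReal (‖f x‖ ^ 2)) x ∂μ) := by
    intro t ht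
    rw [Set.mem_Ioi] at ht
    have hms : MeasurableSet {x | c * t < ‖f x‖} := measurableSet_lt measurable_const hfm.norm
    have hf1 := hf.indicator hms
    have hf2 := hf.indicator hms.compl
    have hdec : f = fun x => {x | c * t < ‖f x‖}.indicator f x +
        {x | c * t < ‖f x‖}ᶜ.indicator f x := by
      funext x
      exact (congrFun (Set.indicator_self_add_compl _ f) x).symm
    have hsmall : ∀ x, ‖S ({x | c * t < ‖f x‖}ᶜ.indicator f) x‖ ≤ t / 2 := by
      intro x
      refine (hS.norm_le _ (c * t) hf2 (fun y => ?_) x).trans (le_of_eq ?_)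
      · by_cases hy : c * t < ‖f y‖
        · simp [hy]; positivity
        · simpa [hy] using le_of_not_gt hy
      · rw [hc]; field_simp
    have hsub : {x | t < ‖S f x‖} ⊆ {x | t / 2 < ‖S ({x | c * t < ‖f x‖}.indicator f) x‖} := by
      intro x hx
      have hx' : t < ‖S f x‖ := hx
      rw [hdec, hS.add _ _ hf1 hf2] at hx'
      have := norm_add_le (S ({x | c * t < ‖f x‖}.indicator f) x)
        (S ({x | c * t < ‖f x‖}ᶜ.indicator f) x)
      have := hsmall x
      rw [Set.mem_ofPred_eq]
      linarith
    calc μ {x | t < ‖S f x‖} * ENNReal.ofReal (t ^ (p - 1))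
        ≤ (ENNReal.ofReal (((t / 2) ^ 2)⁻¹) * (ENNReal.ofReal (A₂ ^ 2) *
          ∫⁻ x, {x | c * t < ‖f x‖}.indicator (fun x => ENNReal.ofReal (‖f x‖ ^ 2)) x ∂μ)) *
          ENNReal.ofReal (t ^ (p - 1)) := by
          gcongr
          refine (measure_mono hsub).trans ?_
          refine (measure_lt_le_lintegral_pow (hS.measurable _ hf1).norm (half_pos ht) 2).trans ?_
          gcongr
          refine (hS.lintegral_sq_le _ hf1).trans (le_of_eq ?_)
          simp_rw [ofReal_norm_indicator_pow _ two_ne_zero]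
      _ = ENNReal.ofReal (((t / 2) ^ 2)⁻¹ * A₂ ^ 2 * t ^ (p - 1)) *
          ∫⁻ x, {x | c * t < ‖f x‖}.indicator (fun x => ENNReal.ofReal (‖f x‖ ^ 2)) x ∂μ := by
          rw [ENNReal.ofReal_mul (by positivity), ENNReal.ofReal_mul (by positivity)]
          ring
      _ = _ := by
          rw [← mul_assoc, ← ENNReal.ofReal_mul (by positivity)]
          congr 2
          rw [show p - 1 = (p - 2 - 1) + (2 : ℕ) by push_cast; ring, Real.rpow_add_natCast ht.ne']
          field_simp
          ring
  calc _ ≤ ENNReal.ofReal p * ∫⁻ t in Set.Ioi (0 : ℝ), ENNReal.ofReal (4 * A₂ ^ 2) *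
        (ENNReal.ofReal (t ^ (p - 2 - 1)) * ∫⁻ x, {x | c * t < ‖f x‖}.indicator
          (fun x => ENNReal.ofReal (‖f x‖ ^ 2)) x ∂μ) := by
        gcongr 1
        exact setLIntegral_mono' measurableSet_Ioi key
    _ ≤ ENNReal.ofReal p * (ENNReal.ofReal (4 * A₂ ^ 2) * ∫⁻ x, ENNReal.ofReal (‖f x‖ ^ 2) *
        ENNReal.ofReal (‖f x‖ ^ (p - 2) * (c ^ (-(p - 2)) / (p - 2))) ∂μ) := by
        rw [lintegral_const_mul' _ _ ENNReal.ofReal_ne_top]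
        gcongr
        exact lintegral_rpow_mul_lintegral_indicator_lt_le hfm.norm (fun x => norm_nonneg _)
          (by fun_prop) (by linarith) hc0
    _ = _ := by
        have hp2 : 0 < p - 2 := by linarith
        simp_rw [fun x => ofReal_pow_mul_ofReal_rpow (y := ‖f x‖)
          (C := c ^ (-(p - 2)) / (p - 2)) (k := 2) (r := p - 2) (norm_nonneg _)
          (show p ≠ 0 by linarith) (by push_cast; ring)]
        rw [lintegral_mul_const' _ _ ENNReal.ofReal_ne_top, mul_comm (∫⁻ x, _ ∂μ), ← mul_assoc,
          ← mul_assoc, ← ENNReal.ofReal_mul (by linarith), ← ENNReal.ofReal_mul (by positivity)]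
        congr 2
        rw [hc, Real.rpow_neg (by positivity), Real.inv_rpow (by positivity), inv_inv]
        ring

theorem HasStrongTypes.lintegral_rpow_le_of_lt_two (hS : HasStrongTypes μ S A₁ A₂) (h₁ : 0 < A₁)
    (h₂ : 0 < A₂) {p : ℝ} (hp1 : 1 < p) (hp : p < 2) {f : X → ℂ} (hf : IsBoundedIntegrable μ f) :
    ∫⁻ x, ENNReal.ofReal (‖S f x‖ ^ p) ∂μ ≤
      ENNReal.ofReal (p * (2 / (p - 1) + 4 / (2 - p)) * (A₁ ^ (2 - p) * A₂ ^ (2 * p - 2))) *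
        ∫⁻ x, ENNReal.ofReal (‖f x‖ ^ p) ∂μ := by
  set c : ℝ := A₁ / A₂ ^ 2 with hc
  have hc0 : 0 < c := by positivity
  have hfm := hf.measurable
  rw [lintegral_rpow_eq_lintegral_meas_lt_mul μ (Eventually.of_forall fun x => norm_nonneg _)
    (hS.measurable f hf).norm.aemeasurable (by linarith)]
  have key : ∀ t ∈ Set.Ioi (0 : ℝ), μ {x | t < ‖S f x‖} * ENNReal.ofReal (t ^ (p - 1)) ≤
      ENNReal.ofReal (2 * A₁) * (ENNReal.ofReal (t ^ (p - 1 - 1)) *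
        ∫⁻ x, {x | c * t < ‖f x‖}.indicator (fun x => ENNReal.ofReal (‖f x‖ ^ 1)) x ∂μ) +
      ENNReal.ofReal (4 * A₂ ^ 2) * (ENNReal.ofReal (t ^ (-(2 - p) - 1)) *
        ∫⁻ x, {x | ‖f x‖ ≤ c * t}.indicator (fun x => ENNReal.ofReal (‖f x‖ ^ 2)) x ∂μ) := by
    intro t ht
    rw [Set.mem_Ioi] at ht
    have hms : MeasurableSet {x | c * t < ‖f x‖} := measurableSet_lt measurable_const hfm.norm
    have hms' : MeasurableSet {x | ‖f x‖ ≤ c * t} := measurableSet_le hfm.norm measurable_const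
    have hf1 := hf.indicator hms
    have hf2 := hf.indicator hms'
    have hdec : f = fun x => {x | c * t < ‖f x‖}.indicator f x +
        {x | ‖f x‖ ≤ c * t}.indicator f x := by
      funext x
      by_cases h : c * t < ‖f x‖
      · simp [h, not_le.2 h]
      · simp [h, le_of_not_gt h]
    have hsub : {x | t < ‖S f x‖} ⊆ {x | t / 2 < ‖S ({x | c * t < ‖f x‖}.indicator f) x‖} ∪
        {x | t / 2 < ‖S ({x | ‖f x‖ ≤ c * t}.indicator f) x‖} := by
      intro x hx
      have hx' : t < ‖S f x‖ := hx
      rw [hdec, hS.add _ _ hf1 hf2] at hx'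
      have := norm_add_le (S ({x | c * t < ‖f x‖}.indicator f) x)
        (S ({x | ‖f x‖ ≤ c * t}.indicator f) x)
      by_contra! h
      simp only [Set.mem_union, Set.mem_ofPred_eq, not_or, not_lt] at h
      linarith [h.1, h.2]
    have m1 : μ {x | t / 2 < ‖S ({x | c * t < ‖f x‖}.indicator f) x‖} ≤
        ENNReal.ofReal (((t / 2) ^ 1)⁻¹) * (ENNReal.ofReal A₁ *
          ∫⁻ x, {x | c * t < ‖f x‖}.indicator (fun x => ENNReal.ofReal (‖f x‖ ^ 1)) x ∂μ) := by
      refine (measure_lt_le_lintegral_pow (hS.measurable _ hf1).norm (half_pos ht) 1).trans ?_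
      gcongr
      simp_rw [← ofReal_norm_indicator_pow _ one_ne_zero, pow_one]
      exact hS.lintegral_le _ hf1
    have m2 : μ {x | t / 2 < ‖S ({x | ‖f x‖ ≤ c * t}.indicator f) x‖} ≤
        ENNReal.ofReal (((t / 2) ^ 2)⁻¹) * (ENNReal.ofReal (A₂ ^ 2) *
          ∫⁻ x, {x | ‖f x‖ ≤ c * t}.indicator (fun x => ENNReal.ofReal (‖f x‖ ^ 2)) x ∂μ) := by
      refine (measure_lt_le_lintegral_pow (hS.measurable _ hf2).norm (half_pos ht) 2).trans ?_
      gcongr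
      simp_rw [← ofReal_norm_indicator_pow _ two_ne_zero]
      exact hS.lintegral_sq_le _ hf2
    refine (mul_le_mul_left ((measure_mono hsub).trans (measure_union_le _ _)) _).trans ?_
    rw [add_mul]
    gcongr ?_ + ?_
    · refine (mul_le_mul_left m1 _).trans (le_of_eq ?_)
      calc _ = ENNReal.ofReal (((t / 2) ^ 1)⁻¹ * A₁ * t ^ (p - 1)) * ∫⁻ x, {x | c * t <
            ‖f x‖}.indicator (fun x => ENNReal.ofReal (‖f x‖ ^ 1)) x ∂μ := by
            rw [ENNReal.ofReal_mul (by positivity), ENNReal.ofReal_mul (by positivity)]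
            ring
        _ = _ := by
            rw [← mul_assoc, ← ENNReal.ofReal_mul (by positivity)]
            congr 2
            rw [show p - 1 = (p - 1 - 1) + (1 : ℕ) by push_cast; ring, Real.rpow_add_natCast ht.ne',
              show p - 1 - 1 + (1 : ℕ) - 1 = p - 1 - 1 by push_cast; ring]
            field_simp
    · refine (mul_le_mul_left m2 _).trans (le_of_eq ?_)
      calc _ = ENNReal.ofReal (((t / 2) ^ 2)⁻¹ * A₂ ^ 2 * t ^ (p - 1)) * ∫⁻ x, {x | ‖f x‖ ≤
            c * t}.indicator (fun x => ENNReal.ofReal (‖f x‖ ^ 2)) x ∂μ := by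
            rw [ENNReal.ofReal_mul (by positivity), ENNReal.ofReal_mul (by positivity)]
            ring
        _ = _ := by
            rw [← mul_assoc, ← ENNReal.ofReal_mul (by positivity)]
            congr 2
            rw [show p - 1 = (-(2 - p) - 1) + (2 : ℕ) by push_cast; ring,
              Real.rpow_add_natCast ht.ne']
            field_simp
            ring
  have hp1' : 0 < p - 1 := by linarith
  have hp2' : 0 < 2 - p := by linarith
  have hmeas : Measurable fun t : ℝ => ENNReal.ofReal (2 * A₁) * (ENNReal.ofReal (t ^ (p - 1 - 1)) *
        ∫⁻ x, {x | c * t < ‖f x‖}.indicator (fun x => ENNReal.ofReal (‖f x‖ ^ 1)) x ∂μ) := by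
    refine Measurable.const_mul (Measurable.mul (by fun_prop) ?_) _
    have : Measurable fun q : ℝ × X => {q : ℝ × X | c * q.1 < ‖f q.2‖}.indicator
        (fun q => ENNReal.ofReal (‖f q.2‖ ^ 1)) q :=
      Measurable.indicator (by fun_prop) (measurableSet_lt (by fun_prop) (by fun_prop))
    exact this.lintegral_prod_right'
  calc _ ≤ ENNReal.ofReal p * ∫⁻ t in Set.Ioi (0 : ℝ),
      (ENNReal.ofReal (2 * A₁) * (ENNReal.ofReal (t ^ (p - 1 - 1)) *
        ∫⁻ x, {x | c * t < ‖f x‖}.indicator (fun x => ENNReal.ofReal (‖f x‖ ^ 1)) x ∂μ) +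
      ENNReal.ofReal (4 * A₂ ^ 2) * (ENNReal.ofReal (t ^ (-(2 - p) - 1)) *
        ∫⁻ x, {x | ‖f x‖ ≤ c * t}.indicator (fun x => ENNReal.ofReal (‖f x‖ ^ 2)) x ∂μ)) := by
        gcongr 1
        exact setLIntegral_mono' measurableSet_Ioi key
    _ ≤ ENNReal.ofReal p * (ENNReal.ofReal (2 * A₁) * (∫⁻ x, ENNReal.ofReal (‖f x‖ ^ 1) *
          ENNReal.ofReal (‖f x‖ ^ (p - 1) * (c ^ (-(p - 1)) / (p - 1))) ∂μ) +
        ENNReal.ofReal (4 * A₂ ^ 2) * ∫⁻ x, ENNReal.ofReal (‖f x‖ ^ 2) *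
          ENNReal.ofReal (‖f x‖ ^ (-(2 - p)) * (c ^ (2 - p) / (2 - p))) ∂μ) := by
        rw [lintegral_add_left hmeas, lintegral_const_mul' _ _ ENNReal.ofReal_ne_top,
          lintegral_const_mul' _ _ ENNReal.ofReal_ne_top]
        gcongr
        · exact lintegral_rpow_mul_lintegral_indicator_lt_le hfm.norm (fun x => norm_nonneg _)
            (by fun_prop) hp1' hc0
        · exact lintegral_rpow_mul_lintegral_indicator_le_le hfm.norm (fun x => norm_nonneg _)
            (by fun_prop) (fun x hx => by simp [hx]) hp2' hc0
    _ = _ := by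
        simp_rw [fun x => ofReal_pow_mul_ofReal_rpow (y := ‖f x‖)
          (C := c ^ (-(p - 1)) / (p - 1)) (k := 1) (r := p - 1) (norm_nonneg _)
          (show p ≠ 0 by linarith) (by push_cast; ring), fun x => ofReal_pow_mul_ofReal_rpow
          (y := ‖f x‖) (C := c ^ (2 - p) / (2 - p)) (k := 2) (r := -(2 - p)) (norm_nonneg _)
          (show p ≠ 0 by linarith) (by push_cast; ring)]
        rw [lintegral_mul_const' _ _ ENNReal.ofReal_ne_top,
          lintegral_mul_const' _ _ ENNReal.ofReal_ne_top, mul_comm (∫⁻ x, _ ∂μ),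
          mul_comm (∫⁻ x, _ ∂μ), ← mul_assoc, ← mul_assoc, ← add_mul, ← mul_assoc,
          ← ENNReal.ofReal_mul (by positivity), ← ENNReal.ofReal_mul (by positivity),
          ← ENNReal.ofReal_add (by positivity) (by positivity), ← ENNReal.ofReal_mul (by linarith)]
        congr 2
        have e1 : A₁ * c ^ (-(p - 1)) = A₁ ^ (2 - p) * A₂ ^ (2 * p - 2) := by
          rw [hc, Real.div_rpow h₁.le (by positivity), ← Real.rpow_natCast, ← Real.rpow_mul h₂.le,
            div_eq_mul_inv, ← Real.rpow_neg h₂.le, ← mul_assoc]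
          congr 1
          · rw [show 2 - p = 1 + -(p - 1) by ring, Real.rpow_add h₁, Real.rpow_one]
          · congr 1; push_cast; ring
        have e2 : A₂ ^ 2 * c ^ (2 - p) = A₁ ^ (2 - p) * A₂ ^ (2 * p - 2) := by
          rw [hc, Real.div_rpow h₁.le (by positivity), ← Real.rpow_natCast, ← Real.rpow_mul h₂.le,
            div_eq_mul_inv, ← Real.rpow_neg h₂.le, mul_left_comm, ← Real.rpow_add h₂]
          congr 2; push_cast; ring
        calc _ = p * (2 / (p - 1) * (A₁ * c ^ (-(p - 1))) +
              4 / (2 - p) * (A₂ ^ 2 * c ^ (2 - p))) := by ring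
          _ = _ := by rw [e1, e2]; ring

end Interpolation

section InterpolationNorm

variable {X : Type*} [MeasurableSpace X] {μ : Measure X}

theorem eLpNorm_le_of_lintegral_rpow_le {f g : X → ℂ} {p B : ℝ} (hp : 0 < p) (hB : 0 ≤ B)
    (h : ∫⁻ x, ENNReal.ofReal (‖g x‖ ^ p) ∂μ ≤
      ENNReal.ofReal B * ∫⁻ x, ENNReal.ofReal (‖f x‖ ^ p) ∂μ) :
    eLpNorm g (ENNReal.ofReal p) μ ≤
      ENNReal.ofReal (B ^ (1 / p)) * eLpNorm f (ENNReal.ofReal p) μ := by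
  have h0 : ENNReal.ofReal p ≠ 0 := by simpa using hp
  have e : ∀ u : X → ℂ, ∫⁻ x, ‖u x‖ₑ ^ p ∂μ = ∫⁻ x, ENNReal.ofReal (‖u x‖ ^ p) ∂μ := fun u =>
    lintegral_congr fun x => by
      rw [← ENNReal.ofReal_rpow_of_nonneg (norm_nonneg _) hp.le, ofReal_norm]
  rw [eLpNorm_eq_lintegral_rpow_enorm_toReal h0 ENNReal.ofReal_ne_top,
    eLpNorm_eq_lintegral_rpow_enorm_toReal h0 ENNReal.ofReal_ne_top, ENNReal.toReal_ofReal hp.le,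
    e, e, ← ENNReal.ofReal_rpow_of_nonneg hB (by positivity),
    ← ENNReal.mul_rpow_of_nonneg _ _ (by positivity)]
  exact ENNReal.rpow_le_rpow h (by positivity)

/-- Marcinkiewicz interpolation between `L¹`, `L²` and `L^∞`. -/
theorem exists_eLpNorm_le_of_hasStrongTypes [SFinite μ] {p : ℝ} (hp : 1 < p) :
    ∃ K : ℝ, 0 ≤ K ∧ ∀ (S : (X → ℂ) → X → ℂ) (A₁ A₂ : ℝ), 0 < A₁ → 0 < A₂ →
      HasStrongTypes μ S A₁ A₂ → ∀ f, IsBoundedIntegrable μ f →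
        eLpNorm (S f) (ENNReal.ofReal p) μ ≤
          ENNReal.ofReal (K * (A₁ ^ |2 / p - 1| * A₂ ^ (1 - |2 / p - 1|))) *
            eLpNorm f (ENNReal.ofReal p) μ := by
  have hp0 : 0 < p := by linarith
  rcases lt_trichotomy p 2 with h | rfl | h
  · have hp1 : 0 < p - 1 := by linarith
    have hp2 : 0 < 2 - p := by linarith
    refine ⟨(p * (2 / (p - 1) + 4 / (2 - p))) ^ (1 / p), by positivity, ?_⟩
    intro S A₁ A₂ h₁ h₂ hS f hf
    refine (eLpNorm_le_of_lintegral_rpow_le hp0 (by positivity)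
      (hS.lintegral_rpow_le_of_lt_two h₁ h₂ hp h hf)).trans (le_of_eq ?_)
    have habs : |2 / p - 1| = 2 / p - 1 := by
      apply abs_of_nonneg
      rw [sub_nonneg, le_div_iff₀ hp0]; linarith
    rw [habs, Real.mul_rpow (x := p * (2 / (p - 1) + 4 / (2 - p))) (by positivity) (by positivity),
      Real.mul_rpow (x := A₁ ^ (2 - p)) (by positivity) (by positivity),
      ← Real.rpow_mul h₁.le, ← Real.rpow_mul h₂.le]
    congr 5 <;> field_simp <;> ring
  · refine ⟨1, by positivity, ?_⟩
    intro S A₁ A₂ h₁ h₂ hS f hf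
    have := hS.lintegral_sq_le f hf
    refine (eLpNorm_le_of_lintegral_rpow_le (f := f) (B := A₂ ^ 2) hp0 (by positivity) ?_).trans
      (le_of_eq ?_)
    · simpa using this
    · congr 2
      rw [← Real.rpow_natCast, ← Real.rpow_mul h₂.le]
      norm_num
  · have hp2 : 0 < p - 2 := by linarith
    refine ⟨(4 * p / (p - 2) * 2 ^ (p - 2)) ^ (1 / p), by positivity, ?_⟩
    intro S A₁ A₂ h₁ h₂ hS f hf
    refine (eLpNorm_le_of_lintegral_rpow_le hp0 (by positivity)
      (hS.lintegral_rpow_le_of_two_lt h₁ h hf)).trans (le_of_eq ?_)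
    have habs : |2 / p - 1| = -(2 / p - 1) := by
      apply abs_of_nonpos
      rw [sub_nonpos, div_le_iff₀ hp0]; linarith
    have e : 4 * p / (p - 2) * (A₂ ^ 2 * (2 * A₁) ^ (p - 2)) =
        4 * p / (p - 2) * 2 ^ (p - 2) * (A₁ ^ (p - 2) * A₂ ^ (2 : ℝ)) := by
      rw [Real.mul_rpow (by positivity) h₁.le, Real.rpow_two]; ring
    rw [habs, e, Real.mul_rpow (x := 4 * p / (p - 2) * 2 ^ (p - 2)) (by positivity) (by positivity),
      Real.mul_rpow (x := A₁ ^ (p - 2)) (by positivity) (by positivity), ← Real.rpow_mul h₁.le,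
      ← Real.rpow_mul h₂.le]
    congr 5 <;> field_simp <;> ring

end InterpolationNorm

theorem lintegral_sq_le_measure_univ_mul {U : Type*} [MeasurableSpace U] {ν : Measure U}
    {v : U → ℝ≥0∞} (hv : AEMeasurable v ν) :
    (∫⁻ u, v u ∂ν) ^ 2 ≤ ν Set.univ * ∫⁻ u, v u ^ 2 ∂ν := by
  have h := ENNReal.lintegral_mul_le_Lp_mul_Lq ν Real.HolderConjugate.two_two
    (f := fun _ => 1) aemeasurable_const hv
  have h2 := pow_le_pow_left₀ zero_le h 2
  simp only [Pi.mul_apply, one_mul, lintegral_one, ENNReal.rpow_two, one_pow] at h2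
  rw [mul_pow, ← ENNReal.rpow_natCast, ← ENNReal.rpow_natCast, ← ENNReal.rpow_natCast,
    ← ENNReal.rpow_mul, ← ENNReal.rpow_mul] at h2
  simpa using h2

section TranslationAverage

variable {U : Type*} [MeasurableSpace U] {E : Type*} [NormedAddCommGroup E]

/-- The weighted average of translates `x ↦ ∫ a(u) f(x - Γ(u)) dν(u)`. -/
noncomputable def translationAverage (ν : Measure U) (a : U → ℂ) (Γ : U → E) (f : E → ℂ) (x : E) :
    ℂ :=
  ∫ u, a u * f (x - Γ u) ∂ν

variable [MeasurableSpace E] [BorelSpace E] [SecondCountableTopology E]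
  {μ : Measure E} {ν : Measure U} {a : U → ℂ} {Γ : U → E} {K : ℝ}

omit [SecondCountableTopology E] in
theorem IsBoundedIntegrable.integrable_translate [IsFiniteMeasure ν] (ha : Measurable a)
    (hΓ : Measurable Γ) (haK : ∀ᵐ u ∂ν, ‖a u‖ ≤ K) {f : E → ℂ} (hf : IsBoundedIntegrable μ f)
    (x : E) : Integrable (fun u => a u * f (x - Γ u)) ν := by
  obtain ⟨M, hM⟩ := hf.bounded
  have hfm := hf.measurable
  refine Integrable.of_bound (C := K * M) (by fun_prop) ?_
  filter_upwards [haK] with u hu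
  rw [norm_mul]
  exact mul_le_mul hu (hM _) (norm_nonneg _) ((norm_nonneg _).trans hu)

theorem measurable_translationAverage [SFinite ν] (ha : Measurable a) (hΓ : Measurable Γ)
    {f : E → ℂ} (hf : Measurable f) : Measurable (translationAverage ν a Γ f) := by
  have : Measurable fun q : E × U => a q.2 * f (q.1 - Γ q.2) := by fun_prop
  exact (this.stronglyMeasurable.integral_prod_right').measurable

omit [SecondCountableTopology E] in
theorem translationAverage_add [IsFiniteMeasure ν] (ha : Measurable a)
    (hΓ : Measurable Γ) (haK : ∀ᵐ u ∂ν, ‖a u‖ ≤ K) {f g : E → ℂ} (hf : IsBoundedIntegrable μ f)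
    (hg : IsBoundedIntegrable μ g) (x : E) :
    translationAverage ν a Γ (fun y => f y + g y) x =
      translationAverage ν a Γ f x + translationAverage ν a Γ g x := by
  simp only [translationAverage, mul_add]
  exact integral_add (hf.integrable_translate ha hΓ haK x) (hg.integrable_translate ha hΓ haK x)

omit [MeasurableSpace E] [BorelSpace E] [SecondCountableTopology E] in
theorem norm_translationAverage_le [IsFiniteMeasure ν] (haK : ∀ᵐ u ∂ν, ‖a u‖ ≤ K)
    {f : E → ℂ} {M : ℝ} (hM : ∀ x, ‖f x‖ ≤ M) (x : E) :
    ‖translationAverage ν a Γ f x‖ ≤ K * ν.real Set.univ * M := by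
  refine (norm_integral_le_of_norm_le_const (C := K * M) ?_).trans (le_of_eq (by ring))
  filter_upwards [haK] with u hu
  rw [norm_mul]
  exact mul_le_mul hu (hM _) (norm_nonneg _) ((norm_nonneg _).trans hu)

omit [MeasurableSpace E] [BorelSpace E] [SecondCountableTopology E] in
theorem enorm_translationAverage_le (haK : ∀ᵐ u ∂ν, ‖a u‖ ≤ K) (f : E → ℂ) (x : E) :
    ‖translationAverage ν a Γ f x‖ₑ ≤ ENNReal.ofReal K * ∫⁻ u, ‖f (x - Γ u)‖ₑ ∂ν := by
  refine (enorm_integral_le_lintegral_enorm _).trans ?_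
  rw [← lintegral_const_mul' _ _ ENNReal.ofReal_ne_top]
  refine lintegral_mono_ae ?_
  filter_upwards [haK] with u hu
  rw [enorm_mul, ← ofReal_norm (a u)]
  gcongr

variable [SFinite μ] [μ.IsAddRightInvariant]

theorem lintegral_lintegral_sub [SFinite ν] (hΓ : Measurable Γ) {w : E → ℝ≥0∞}
    (hw : Measurable w) : ∫⁻ x, (∫⁻ u, w (x - Γ u) ∂ν) ∂μ = ν Set.univ * ∫⁻ x, w x ∂μ := by
  rw [lintegral_lintegral_swap (Measurable.aemeasurable (by fun_prop))]
  simp_rw [fun u => lintegral_sub_right_eq_self (μ := μ) w (Γ u)]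
  rw [lintegral_const, mul_comm]

theorem lintegral_enorm_translationAverage_le [IsFiniteMeasure ν] (hΓ : Measurable Γ)
    (hK : 0 ≤ K) (haK : ∀ᵐ u ∂ν, ‖a u‖ ≤ K) {f : E → ℂ} (hf : Measurable f) :
    ∫⁻ x, ‖translationAverage ν a Γ f x‖ₑ ∂μ ≤
      ENNReal.ofReal (K * ν.real Set.univ) * ∫⁻ x, ‖f x‖ₑ ∂μ := by
  refine (lintegral_mono fun x => enorm_translationAverage_le haK f x).trans ?_
  rw [lintegral_const_mul' _ _ ENNReal.ofReal_ne_top, lintegral_lintegral_sub hΓ hf.enorm,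
    ENNReal.ofReal_mul hK, ofReal_measureReal, mul_assoc]

theorem lintegral_enorm_sq_translationAverage_le [IsFiniteMeasure ν] (hΓ : Measurable Γ)
    (hK : 0 ≤ K) (haK : ∀ᵐ u ∂ν, ‖a u‖ ≤ K) {f : E → ℂ} (hf : Measurable f) :
    ∫⁻ x, ‖translationAverage ν a Γ f x‖ₑ ^ 2 ∂μ ≤
      ENNReal.ofReal ((K * ν.real Set.univ) ^ 2) * ∫⁻ x, ‖f x‖ₑ ^ 2 ∂μ := by
  have h : ∀ x, ‖translationAverage ν a Γ f x‖ₑ ^ 2 ≤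
      ENNReal.ofReal K ^ 2 * ν Set.univ * ∫⁻ u, ‖f (x - Γ u)‖ₑ ^ 2 ∂ν := by
    intro x
    refine (pow_le_pow_left₀ zero_le (enorm_translationAverage_le haK f x) 2).trans ?_
    rw [mul_pow, mul_assoc]
    gcongr
    exact lintegral_sq_le_measure_univ_mul (Measurable.aemeasurable (by fun_prop))
  refine (lintegral_mono h).trans (le_of_eq ?_)
  rw [lintegral_const_mul' _ _ (ENNReal.mul_ne_top (by simp) (measure_ne_top _ _)),
    lintegral_lintegral_sub hΓ (w := fun x => ‖f x‖ₑ ^ 2) (by fun_prop),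
    ENNReal.ofReal_pow (by positivity), ENNReal.ofReal_mul hK, ofReal_measureReal]
  ring

end TranslationAverage

theorem integrable_prod_of_bounded {V U : Type*} [MeasurableSpace V] [MeasurableSpace U]
    {μ : Measure V} [SFinite μ] {ν : Measure U} [SFinite ν] {w : V → ℂ} {a : U → ℂ}
    (hw : Integrable w μ) (ha : Integrable a ν) {h : V → U → ℂ}
    (hh : Measurable (Function.uncurry h)) {B : ℝ} (hB : ∀ x u, ‖h x u‖ ≤ B) :
    Integrable (Function.uncurry fun x u => a u * h x u * w x) (μ.prod ν) := by
  have h1 := (hw.mul_prod ha).norm.const_mul B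
  refine h1.mono' ?_ (Eventually.of_forall fun q => ?_)
  · exact (ha.aestronglyMeasurable.comp_snd.mul hh.aestronglyMeasurable).mul
      hw.aestronglyMeasurable.comp_fst
  · simp only [Function.uncurry, norm_mul]
    calc _ = ‖h q.1 q.2‖ * (‖w q.1‖ * ‖a q.2‖) := by ring
      _ ≤ _ := by gcongr; exact hB _ _

section FourierMultiplier

open FourierTransform
open scoped SchwartzMap

variable {V : Type*} [NormedAddCommGroup V] [InnerProductSpace ℝ V] [FiniteDimensional ℝ V]
  [MeasurableSpace V] [BorelSpace V]

theorem fourier_compSubConst (f : 𝓢(V, ℂ)) (y ξ : V) :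
    𝓕 (f.compSubConstCLM ℂ y) ξ =
      Complex.exp ((-2 * π * inner ℝ y ξ : ℝ) * Complex.I) * 𝓕 f ξ := by
  rw [SchwartzMap.fourier_coe, SchwartzMap.fourier_coe, Real.fourier_eq', Real.fourier_eq',
    ← integral_add_right_eq_self _ y, ← integral_const_mul]
  refine integral_congr_ae (Eventually.of_forall fun x => ?_)
  simp only [SchwartzMap.compSubConstCLM_apply, add_sub_cancel_right, smul_eq_mul, inner_add_left]
  rw [← mul_assoc, ← Complex.exp_add]
  congr 2
  push_cast
  ring

variable {U : Type*} [MeasurableSpace U] {ν : Measure U} [IsFiniteMeasure ν] {a : U → ℂ}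
  {Γ : U → V} {K : ℝ}

/-- The Fourier multiplier of `translationAverage ν a Γ`. -/
noncomputable def translationMultiplier (ν : Measure U) (a : U → ℂ) (Γ : U → V) (ξ : V) : ℂ :=
  ∫ u, a u * Complex.exp ((-2 * π * inner ℝ (Γ u) ξ : ℝ) * Complex.I) ∂ν

theorem integral_inner_translationAverage (ha : Integrable a ν) (hΓ : Measurable Γ)
    (f g : 𝓢(V, ℂ)) :
    ∫ x, inner ℂ (g x) (translationAverage ν a Γ f x) =
      ∫ ξ, inner ℂ (𝓕 g ξ) (translationMultiplier ν a Γ ξ * 𝓕 f ξ) := by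
  obtain ⟨B, hB⟩ : ∃ B, ∀ x, ‖f x‖ ≤ B :=
    ⟨_, fun x => f.toBoundedContinuousFunction.norm_coe_le_norm x⟩
  have hf : Measurable f := f.continuous.measurable
  have hcg : Integrable (fun x => (starRingEnd ℂ) (g x)) :=
    (g.integrable).norm.mono' (by have := g.continuous; fun_prop)
      (Eventually.of_forall fun x => by simp)
  have hcF : Integrable (fun ξ => 𝓕 f ξ * (starRingEnd ℂ) (𝓕 g ξ)) := by
    obtain ⟨B', hB'⟩ : ∃ B, ∀ x, ‖𝓕 f x‖ ≤ B :=
      ⟨_, fun x => (𝓕 f).toBoundedContinuousFunction.norm_coe_le_norm x⟩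
    refine Integrable.bdd_mul (c := B') ?_ (𝓕 f).continuous.aestronglyMeasurable
      (Eventually.of_forall hB')
    exact ((𝓕 g).integrable).norm.mono' (by have := (𝓕 g).continuous; fun_prop)
      (Eventually.of_forall fun x => by simp)
  have i1 := integrable_prod_of_bounded (ν := ν) (μ := volume) hcg ha
    (h := fun x u => f (x - Γ u)) (by unfold Function.uncurry; fun_prop) (fun x u => hB _)
  have i2 := integrable_prod_of_bounded (ν := ν) (μ := volume) hcF ha
    (h := fun ξ u => Complex.exp ((-2 * π * inner ℝ (Γ u) ξ : ℝ) * Complex.I))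
    (by unfold Function.uncurry; fun_prop) (B := 1)
    (fun x u => (Complex.norm_exp_ofReal_mul_I _).le)
  calc ∫ x, inner ℂ (g x) (translationAverage ν a Γ f x)
      = ∫ x, ∫ u, a u * f (x - Γ u) * (starRingEnd ℂ) (g x) ∂ν := by
        refine integral_congr_ae (Eventually.of_forall fun x => ?_)
        simp only [RCLike.inner_apply, translationAverage]
        rw [← integral_mul_const]
    _ = ∫ u, (∫ x, a u * f (x - Γ u) * (starRingEnd ℂ) (g x)) ∂ν := integral_integral_swap i1
    _ = ∫ u, (∫ ξ, a u * Complex.exp ((-2 * π * inner ℝ (Γ u) ξ : ℝ) * Complex.I) *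
          (𝓕 f ξ * (starRingEnd ℂ) (𝓕 g ξ))) ∂ν := by
        refine integral_congr_ae (Eventually.of_forall fun u => ?_)
        have h := SchwartzMap.integral_inner_fourier_fourier g (f.compSubConstCLM ℂ (Γ u))
        simp only [RCLike.inner_apply, fourier_compSubConst, SchwartzMap.compSubConstCLM_apply] at h
        simp only [mul_assoc, integral_const_mul] at h ⊢
        rw [h]
    _ = ∫ ξ, ∫ u, a u * Complex.exp ((-2 * π * inner ℝ (Γ u) ξ : ℝ) * Complex.I) *
          (𝓕 f ξ * (starRingEnd ℂ) (𝓕 g ξ)) ∂ν := (integral_integral_swap i2).symm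
    _ = _ := by
        refine integral_congr_ae (Eventually.of_forall fun ξ => ?_)
        simp only [RCLike.inner_apply, translationMultiplier]
        rw [integral_mul_const, mul_assoc]

theorem measurable_translationMultiplier (ha : Measurable a) (hΓ : Measurable Γ) :
    Measurable (translationMultiplier ν a Γ) := by
  have : Measurable fun q : V × U =>
      a q.2 * Complex.exp ((-2 * π * inner ℝ (Γ q.2) q.1 : ℝ) * Complex.I) := by fun_prop
  exact (this.stronglyMeasurable.integral_prod_right').measurable

theorem norm_integral_inner_translationAverage_le (ha : Measurable a) (hai : Integrable a ν)
    (hΓ : Measurable Γ) {A : ℝ} (hA : ∀ ξ, ‖translationMultiplier ν a Γ ξ‖ ≤ A) (f g : 𝓢(V, ℂ)) :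
    ‖∫ x, inner ℂ (g x) (translationAverage ν a Γ f x)‖ ≤ A * ‖f.toLp 2‖ * ‖g.toLp 2‖ := by
  have hA0 : 0 ≤ A := (norm_nonneg _).trans (hA 0)
  have hm : MemLp (fun ξ => translationMultiplier ν a Γ ξ * 𝓕 f ξ) 2 volume :=
    ((𝓕 f).memLp 2).of_le_mul (c := A)
      ((measurable_translationMultiplier ha hΓ).mul
        (𝓕 f).continuous.measurable).aestronglyMeasurable
      (Eventually.of_forall fun ξ => by rw [norm_mul]; gcongr; exact hA ξ)
  have e : ∫ ξ, inner ℂ (𝓕 g ξ) (translationMultiplier ν a Γ ξ * 𝓕 f ξ) =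
      inner ℂ ((𝓕 g).toLp 2) hm.toLp := by
    rw [L2.inner_def]
    refine integral_congr_ae ?_
    filter_upwards [(𝓕 g).coeFn_toLp 2, hm.coeFn_toLp] with ξ h1 h2
    rw [h1, h2]
  rw [integral_inner_translationAverage hai hΓ, e]
  refine (norm_inner_le_norm _ _).trans ?_
  rw [SchwartzMap.norm_fourier_toL2_eq, mul_comm]
  gcongr
  rw [← SchwartzMap.norm_fourier_toL2_eq f]
  refine Lp.norm_le_mul_norm_of_ae_le_mul ?_
  filter_upwards [(𝓕 f).coeFn_toLp 2, hm.coeFn_toLp] with ξ h1 h2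
  rw [h1, h2, norm_mul]
  gcongr
  exact hA ξ

end FourierMultiplier

section StrongType

open scoped SchwartzMap

theorem eLpNorm_two_sq {X : Type*} [MeasurableSpace X] {μ : Measure X} (f : X → ℂ) :
    eLpNorm f 2 μ ^ 2 = ∫⁻ x, ‖f x‖ₑ ^ 2 ∂μ := by
  have h := eLpNorm_nnreal_pow_eq_lintegral (f := f) (μ := μ) (p := 2) two_ne_zero
  simpa only [NNReal.coe_ofNat, ENNReal.rpow_two, ENNReal.coe_ofNat] using h

theorem ofReal_norm_sq (z : ℂ) : ENNReal.ofReal (‖z‖ ^ 2) = ‖z‖ₑ ^ 2 := by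
  rw [ENNReal.ofReal_pow (norm_nonneg _), ofReal_norm]

variable {V : Type*} [NormedAddCommGroup V] [InnerProductSpace ℝ V] [FiniteDimensional ℝ V]
  [MeasurableSpace V] [BorelSpace V]

theorem SchwartzMap.isBoundedIntegrable (f : 𝓢(V, ℂ)) : IsBoundedIntegrable volume f where
  measurable := f.continuous.measurable
  bounded := ⟨_, fun x => f.toBoundedContinuousFunction.norm_coe_le_norm x⟩
  integrable := f.integrable

theorem eLpNorm_le_of_forall_schwartz {F : V → ℂ} (hF : MemLp F 2 volume) {C : ℝ} (hC : 0 ≤ C)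
    (h : ∀ g : 𝓢(V, ℂ), ‖∫ x, inner ℂ (g x) (F x)‖ ≤ C * ‖g.toLp 2‖) :
    eLpNorm F 2 volume ≤ ENNReal.ofReal C := by
  rw [← ENNReal.ofReal_toReal hF.2.ne, ← Lp.norm_toLp F hF]
  apply ENNReal.ofReal_le_ofReal
  have key : ∀ G : Lp ℂ 2 (volume : Measure V), ‖inner ℂ G hF.toLp‖ ≤ C * ‖G‖ := by
    intro G
    refine (SchwartzMap.denseRange_toLpCLM (F := ℂ) (p := 2)
      (μ := (volume : Measure V)) (by simp)).induction_on
      (p := fun G => ‖inner ℂ G hF.toLp‖ ≤ C * ‖G‖) G ?_ ?_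
    · exact isClosed_le (by fun_prop) (by fun_prop)
    · intro g
      refine le_trans (le_of_eq ?_) (h g)
      congr 1
      rw [L2.inner_def]
      refine integral_congr_ae ?_
      filter_upwards [g.coeFn_toLp 2, hF.coeFn_toLp] with x h1 h2
      rw [SchwartzMap.toLpCLM_apply, h1, h2]
  have h1 := key hF.toLp
  rw [inner_self_eq_norm_sq_to_K, norm_pow, RCLike.norm_ofReal, abs_norm, sq] at h1
  by_contra! hlt
  nlinarith

variable {U : Type*} [MeasurableSpace U] {ν : Measure U} [IsFiniteMeasure ν] {a : U → ℂ}
  {Γ : U → V} {K : ℝ}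

theorem eLpNorm_two_translationAverage_le_crude (hΓ : Measurable Γ) (hK : 0 ≤ K)
    (haK : ∀ᵐ u ∂ν, ‖a u‖ ≤ K) {f : V → ℂ} (hf : Measurable f) :
    eLpNorm (translationAverage ν a Γ f) 2 volume ≤
      ENNReal.ofReal (K * ν.real Set.univ) * eLpNorm f 2 volume := by
  rw [← ENNReal.pow_le_pow_left_iff two_ne_zero, mul_pow, eLpNorm_two_sq, eLpNorm_two_sq,
    ← ENNReal.ofReal_pow (by positivity)]
  exact lintegral_enorm_sq_translationAverage_le hΓ hK haK hf

theorem memLp_two_translationAverage (ha : Measurable a) (hΓ : Measurable Γ) (hK : 0 ≤ K)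
    (haK : ∀ᵐ u ∂ν, ‖a u‖ ≤ K) {f : V → ℂ} (hfm : Measurable f) (hf : MemLp f 2 volume) :
    MemLp (translationAverage ν a Γ f) 2 volume := by
  refine ⟨(measurable_translationAverage ha hΓ hfm).aestronglyMeasurable, ?_⟩
  exact lt_of_le_of_lt (eLpNorm_two_translationAverage_le_crude hΓ hK haK hfm)
    (ENNReal.mul_lt_top ENNReal.ofReal_lt_top hf.2)

theorem eLpNorm_two_translationAverage_schwartz_le (ha : Measurable a) (hΓ : Measurable Γ)
    (hK : 0 ≤ K) (haK : ∀ᵐ u ∂ν, ‖a u‖ ≤ K) {A : ℝ}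
    (hA : ∀ ξ, ‖translationMultiplier ν a Γ ξ‖ ≤ A) (f : 𝓢(V, ℂ)) :
    eLpNorm (translationAverage ν a Γ f) 2 volume ≤ ENNReal.ofReal A * eLpNorm f 2 volume := by
  have hai : Integrable a ν := Integrable.of_bound ha.aestronglyMeasurable K haK
  have hA0 : 0 ≤ A := (norm_nonneg _).trans (hA 0)
  have hF : MemLp (translationAverage ν a Γ f) 2 volume :=
    memLp_two_translationAverage ha hΓ hK haK f.continuous.measurable (f.memLp 2 volume)
  have e : ‖f.toLp 2‖ = (eLpNorm f 2 volume).toReal := f.norm_toLp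
  have h := eLpNorm_le_of_forall_schwartz hF (mul_nonneg hA0 (norm_nonneg _))
    (norm_integral_inner_translationAverage_le ha hai hΓ hA f)
  rwa [e, ENNReal.ofReal_mul hA0, ENNReal.ofReal_toReal (f.memLp 2 volume).2.ne] at h

theorem eLpNorm_two_translationAverage_le (ha : Measurable a) (hΓ : Measurable Γ)
    (hK : 0 ≤ K) (haK : ∀ᵐ u ∂ν, ‖a u‖ ≤ K) {A : ℝ}
    (hA : ∀ ξ, ‖translationMultiplier ν a Γ ξ‖ ≤ A) {f : V → ℂ}
    (hf : IsBoundedIntegrable volume f) :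
    eLpNorm (translationAverage ν a Γ f) 2 volume ≤ ENNReal.ofReal A * eLpNorm f 2 volume := by
  obtain ⟨M, hM⟩ := hf.bounded
  have hf2 : MemLp f 2 volume := by
    rw [memLp_two_iff_integrable_sq_norm hf.measurable.aestronglyMeasurable]
    refine (hf.integrable.norm.const_mul M).mono' (by have := hf.measurable; fun_prop)
      (Eventually.of_forall fun x => ?_)
    rw [norm_pow, norm_norm, sq]
    exact mul_le_mul_of_nonneg_right (hM x) (norm_nonneg _)
  have hA0 : 0 ≤ A := (norm_nonneg _).trans (hA 0)
  have hKν : 0 ≤ K * ν.real Set.univ := by positivity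
  have key : ∀ ε : ℝ, 0 < ε → eLpNorm (translationAverage ν a Γ f) 2 volume ≤
      ENNReal.ofReal A * eLpNorm f 2 volume +
        ENNReal.ofReal ((K * ν.real Set.univ + A) * ε) := by
    intro ε hε
    obtain ⟨g, hg1, hg2, hg3⟩ := hf2.exist_eLpNorm_sub_le (by simp) (by simp) hε
    set φ : 𝓢(V, ℂ) := hg1.toSchwartzMap hg2
    have hφ : ∀ x, φ x = g x := fun x => rfl
    have hφb := SchwartzMap.isBoundedIntegrable φ
    have hd : IsBoundedIntegrable volume (fun x => f x - φ x) := by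
      obtain ⟨M', hM'⟩ := hφb.bounded
      exact ⟨hf.measurable.sub hφb.measurable, ⟨M + M', fun x =>
        (norm_sub_le _ _).trans (add_le_add (hM x) (hM' x))⟩, hf.integrable.sub hφb.integrable⟩
    have hdec : translationAverage ν a Γ f =
        translationAverage ν a Γ (fun x => f x - φ x) + translationAverage ν a Γ φ := by
      funext x
      rw [Pi.add_apply, ← translationAverage_add ha hΓ haK hd hφb]
      simp
    have hdn : eLpNorm (fun x => f x - φ x) 2 volume ≤ ENNReal.ofReal ε := hg3
    have hφn : eLpNorm φ 2 volume ≤ eLpNorm f 2 volume + ENNReal.ofReal ε := by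
      have : (φ : V → ℂ) = f - (fun x => f x - φ x) := by funext x; simp
      rw [this]
      refine (eLpNorm_sub_le hf.measurable.aestronglyMeasurable
        hd.measurable.aestronglyMeasurable (by simp)).trans ?_
      gcongr
    rw [hdec]
    refine (eLpNorm_add_le (measurable_translationAverage ha hΓ hd.measurable).aestronglyMeasurable
      (measurable_translationAverage ha hΓ hφb.measurable).aestronglyMeasurable (by simp)).trans ?_
    calc _ ≤ ENNReal.ofReal (K * ν.real Set.univ) * ENNReal.ofReal ε +
          ENNReal.ofReal A * (eLpNorm f 2 volume + ENNReal.ofReal ε) := by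
          gcongr
          · exact (eLpNorm_two_translationAverage_le_crude hΓ hK haK hd.measurable).trans
              (by gcongr)
          · exact (eLpNorm_two_translationAverage_schwartz_le ha hΓ hK haK hA φ).trans
              (by gcongr)
      _ = _ := by
          rw [add_mul, ENNReal.ofReal_add (by positivity) (by positivity),
            ENNReal.ofReal_mul hKν, ENNReal.ofReal_mul hA0]
          ring
  have hlim : Tendsto (fun ε : ℝ => ENNReal.ofReal A * eLpNorm f 2 volume +
      ENNReal.ofReal ((K * ν.real Set.univ + A) * ε)) (𝓝[>] 0)
      (𝓝 (ENNReal.ofReal A * eLpNorm f 2 volume +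
        ENNReal.ofReal ((K * ν.real Set.univ + A) * 0))) := by
    refine Tendsto.mono_left (Tendsto.add tendsto_const_nhds ?_) nhdsWithin_le_nhds
    exact (ENNReal.continuous_ofReal.comp (by fun_prop)).tendsto _
  rw [mul_zero, ENNReal.ofReal_zero, add_zero] at hlim
  exact ge_of_tendsto hlim (eventually_nhdsWithin_of_forall key)

theorem hasStrongTypes_translationAverage (ha : Measurable a) (hΓ : Measurable Γ)
    (hK : 0 ≤ K) (haK : ∀ᵐ u ∂ν, ‖a u‖ ≤ K) {A : ℝ}
    (hA : ∀ ξ, ‖translationMultiplier ν a Γ ξ‖ ≤ A) :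
    HasStrongTypes volume (translationAverage ν a Γ) (K * ν.real Set.univ) A where
  measurable f hf := measurable_translationAverage ha hΓ hf.measurable
  add f g hf hg x := translationAverage_add ha hΓ haK hf hg x
  norm_le f M _ hM x := norm_translationAverage_le haK hM x
  lintegral_le f hf := by
    simp_rw [ofReal_norm]
    exact lintegral_enorm_translationAverage_le hΓ hK haK hf.measurable
  lintegral_sq_le f hf := by
    simp_rw [ofReal_norm_sq]
    rw [← eLpNorm_two_sq, ← eLpNorm_two_sq, ENNReal.ofReal_pow ((norm_nonneg _).trans (hA 0)),
      ← mul_pow]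
    gcongr
    exact eLpNorm_two_translationAverage_le ha hΓ hK haK hA hf

end StrongType

section DyadicPieces

open scoped SchwartzMap

/-- The piece of the half-line singular integral along `γ` on `exp (-v) ≤ t ≤ exp (-u)`, written in
the variable `s = -log t`. -/
noncomputable def annularPiece {d : ℕ} (γ : ℝ → EuclideanSpace ℝ (Fin d)) (α β u v : ℝ) :
    (EuclideanSpace ℝ (Fin d) → ℂ) → EuclideanSpace ℝ (Fin d) → ℂ :=
  translationAverage (volume.restrict (Set.Ioc u v))
    (fun s => (Real.exp (α * s) : ℂ) * Complex.exp (Complex.I * (Real.exp (β * s) : ℂ)))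
    (fun s => γ (Real.exp (-s)))

theorem IsWellCurved.exists_hasStrongTypes_annularPiece {d : ℕ}
    {γ : ℝ → EuclideanSpace ℝ (Fin d)} (hγ : IsWellCurved d γ) {α β : ℝ} (hα : 0 ≤ α)
    (hβ : 0 < β) :
    ∃ h₀ C : ℝ, 0 < h₀ ∧ 0 < C ∧ ∀ h, 0 < h → h ≤ h₀ → ∀ u, 0 ≤ u →
      HasStrongTypes volume (annularPiece γ α β u (u + h)) (Real.exp (α * (u + h)) * h)
        (C * Real.exp (-(β / (d + 1)) * u) * Real.exp (α * (u + h))) := by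
  obtain ⟨h₀, C, hh₀, hC, hosc⟩ := hγ.exists_oscillatory_bound hβ
  refine ⟨h₀, 2 * (C + 1), hh₀, by positivity, fun h hh hhh u hu => ?_⟩
  have hγc : Continuous γ := hγ.1.continuous
  have key := hasStrongTypes_translationAverage (ν := volume.restrict (Set.Ioc u (u + h)))
    (a := fun s => (Real.exp (α * s) : ℂ) * Complex.exp (Complex.I * (Real.exp (β * s) : ℂ)))
    (Γ := fun s => γ (Real.exp (-s))) (K := Real.exp (α * (u + h)))
    (A := 2 * (C + 1) * Real.exp (-(β / (d + 1)) * u) * Real.exp (α * (u + h)))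
    (by fun_prop) (by fun_prop) (Real.exp_pos _).le ?_ ?_
  · simpa [Measure.real, hh.le, annularPiece] using key
  · refine (ae_restrict_iff' measurableSet_Ioc).2 (Eventually.of_forall fun s hs => ?_)
    rw [norm_mul, mul_comm Complex.I, Complex.norm_exp_ofReal_mul_I, mul_one, Complex.norm_real,
      Real.norm_eq_abs, Real.abs_exp]
    gcongr
    exact hs.2
  · intro ξ
    have h1 := norm_integral_exp_amplitude_le
      (φ := fun s => Real.exp (β * s) - inner ℝ ((2 * π) • ξ) (γ (Real.exp (-s))))
      (by fun_prop) hα hh.le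
      (M := C * Real.exp (-(β / (d + 1)) * u)) (u := u)
      (fun v hv => hosc _ u hu v ⟨hv.1, hv.2.trans (by linarith)⟩)
    have h2 : translationMultiplier (volume.restrict (Set.Ioc u (u + h)))
        (fun s => (Real.exp (α * s) : ℂ) * Complex.exp (Complex.I * (Real.exp (β * s) : ℂ)))
        (fun s => γ (Real.exp (-s))) ξ = ∫ s in u..(u + h), (Real.exp (α * s) : ℂ) *
          Complex.exp (Complex.I * ((Real.exp (β * s) -
            inner ℝ ((2 * π) • ξ) (γ (Real.exp (-s))) : ℝ) : ℂ)) := by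
      rw [intervalIntegral.integral_of_le (by linarith), translationMultiplier]
      refine integral_congr_ae (Eventually.of_forall fun s => ?_)
      simp only
      rw [mul_assoc, ← Complex.exp_add, real_inner_smul_left, real_inner_comm]
      congr 2
      push_cast
      ring
    rw [h2]
    refine h1.trans ?_
    rw [← mul_assoc]
    gcongr
    linarith

theorem rpow_mul_rpow_exp_eq {h C α κ u b : ℝ} (hh : 0 < h) (hC : 0 < C) :
    (Real.exp (α * (u + h)) * h) ^ b *
        (C * Real.exp (-κ * u) * Real.exp (α * (u + h))) ^ (1 - b) =
      (Real.exp (α * h) * h ^ b * C ^ (1 - b)) * Real.exp (-(κ * (1 - b) - α) * u) := by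
  rw [Real.mul_rpow (Real.exp_pos _).le hh.le, Real.mul_rpow (by positivity) (Real.exp_pos _).le,
    Real.mul_rpow hC.le (Real.exp_pos _).le, ← Real.exp_mul, ← Real.exp_mul, ← Real.exp_mul]
  calc _ = h ^ b * C ^ (1 - b) * (Real.exp (α * (u + h) * b) * Real.exp (-κ * u * (1 - b)) *
        Real.exp (α * (u + h) * (1 - b))) := by ring
    _ = h ^ b * C ^ (1 - b) * (Real.exp (α * h) * Real.exp (-(κ * (1 - b) - α) * u)) := by
        rw [← Real.exp_add, ← Real.exp_add, ← Real.exp_add]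
        congr 2
        ring
    _ = _ := by ring

theorem IsWellCurved.exists_eLpNorm_annularPiece_le {d : ℕ}
    {γ : ℝ → EuclideanSpace ℝ (Fin d)} (hγ : IsWellCurved d γ) {α β : ℝ} (hα : 0 ≤ α)
    (hβ : 0 < β) {p : ℝ} (hp : 1 < p) :
    ∃ h₀, 0 < h₀ ∧ ∀ h, 0 < h → h ≤ h₀ → ∃ K, 0 ≤ K ∧ ∀ u, 0 ≤ u →
      ∀ f : 𝓢(EuclideanSpace ℝ (Fin d), ℂ),
        eLpNorm (annularPiece γ α β u (u + h) f) (ENNReal.ofReal p) volume ≤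
          ENNReal.ofReal
            (K * Real.exp (-(β / (d + 1) * (1 - |2 / p - 1|) - α) * u)) *
            eLpNorm f (ENNReal.ofReal p) volume := by
  obtain ⟨h₀, C, hh₀, hC, hst⟩ := hγ.exists_hasStrongTypes_annularPiece hα hβ
  obtain ⟨K, hK, hint⟩ := exists_eLpNorm_le_of_hasStrongTypes
    (X := EuclideanSpace ℝ (Fin d)) (μ := volume) hp
  refine ⟨h₀, hh₀, fun h hh hhh => ⟨K * (Real.exp (α * h) * h ^ |2 / p - 1| *
    C ^ (1 - |2 / p - 1|)), by positivity, fun u hu f => ?_⟩⟩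
  have := hint _ _ _ (by positivity) (by positivity) (hst h hh hhh u hu) f
    (SchwartzMap.isBoundedIntegrable f)
  rwa [rpow_mul_rpow_exp_eq hh hC, ← mul_assoc] at this

end DyadicPieces

section Assembly

open scoped SchwartzMap

variable {d : ℕ} {γ : ℝ → EuclideanSpace ℝ (Fin d)} {α β : ℝ}

theorem annularPiece_eq_intervalIntegral {u v : ℝ} (huv : u ≤ v)
    (f : EuclideanSpace ℝ (Fin d) → ℂ) (x : EuclideanSpace ℝ (Fin d)) :
    annularPiece γ α β u v f x = ∫ s in u..v, (Real.exp (α * s) : ℂ) *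
      Complex.exp (Complex.I * (Real.exp (β * s) : ℂ)) * f (x - γ (Real.exp (-s))) := by
  rw [intervalIntegral.integral_of_le huv]
  rfl

theorem sum_annularPiece (hγ : Continuous γ) {f : EuclideanSpace ℝ (Fin d) → ℂ}
    (hf : Continuous f) {h : ℝ} (hh : 0 ≤ h) (n : ℕ) (x : EuclideanSpace ℝ (Fin d)) :
    ∑ j ∈ Finset.range n, annularPiece γ α β (j * h) (j * h + h) f x =
      annularPiece γ α β 0 (n * h) f x := by
  have hc : Continuous fun s : ℝ => (Real.exp (α * s) : ℂ) *
      Complex.exp (Complex.I * (Real.exp (β * s) : ℂ)) * f (x - γ (Real.exp (-s))) := by fun_prop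
  have h1 := intervalIntegral.sum_integral_adjacent_intervals (a := fun j : ℕ => j * h) (n := n)
    (μ := volume) (fun k _ => hc.intervalIntegrable _ _)
  rw [annularPiece_eq_intervalIntegral (by positivity)]
  simp only [Nat.cast_zero, zero_mul] at h1
  rw [← h1]
  refine Finset.sum_congr rfl fun j _ => ?_
  rw [annularPiece_eq_intervalIntegral (by linarith)]
  congr 1
  push_cast
  ring

theorem continuousOn_singularKernel (hγ : Continuous γ)
    {f : EuclideanSpace ℝ (Fin d) → ℂ} (hf : Continuous f) (x : EuclideanSpace ℝ (Fin d)) :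
    ContinuousOn (fun t : ℝ => (t : ℂ)⁻¹ * ((|t| ^ (-α) : ℝ) : ℂ) *
      Complex.exp (Complex.I * ((|t| ^ (-β) : ℝ) : ℂ)) * f (x - γ t)) {0}ᶜ := by
  intro t (ht : t ≠ 0)
  have ht' : (t : ℂ) ≠ 0 := by exact_mod_cast ht
  have h1 : ∀ c : ℝ, ContinuousAt (fun t : ℝ => ((|t| ^ c : ℝ) : ℂ)) t := fun c =>
    Complex.continuous_ofReal.continuousAt.comp
      (continuous_abs.continuousAt.rpow_const (Or.inl (abs_ne_zero.2 ht)))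
  refine ContinuousAt.continuousWithinAt ?_
  exact (((Complex.continuous_ofReal.continuousAt.inv₀ ht').mul (h1 _)).mul
    (Complex.continuous_exp.continuousAt.comp (continuousAt_const.mul (h1 _)))).mul
    (hf.comp (continuous_const.sub hγ)).continuousAt

theorem integral_exp_neg_one_eq_annularPiece (hγ : Continuous γ)
    {f : EuclideanSpace ℝ (Fin d) → ℂ} (hf : Continuous f) {r : ℝ} (hr : 0 ≤ r)
    (x : EuclideanSpace ℝ (Fin d)) :
    ∫ t in (Real.exp (-r))..1, (t : ℂ)⁻¹ * ((|t| ^ (-α) : ℝ) : ℂ) *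
        Complex.exp (Complex.I * ((|t| ^ (-β) : ℝ) : ℂ)) * f (x - γ t) =
      annularPiece γ α β 0 r f x := by
  have h := intervalIntegral.integral_deriv_smul_comp' (a := r) (b := 0)
    (f := fun s => Real.exp (-s)) (f' := fun s => -Real.exp (-s))
    (g := fun t : ℝ => (t : ℂ)⁻¹ * ((|t| ^ (-α) : ℝ) : ℂ) *
        Complex.exp (Complex.I * ((|t| ^ (-β) : ℝ) : ℂ)) * f (x - γ t))
    (fun s _ => by simpa using (hasDerivAt_neg s).exp)
    (by fun_prop)
    ((continuousOn_singularKernel hγ hf x).mono (by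
      rintro _ ⟨s, -, rfl⟩
      exact (Real.exp_pos _).ne'))
  simp only [neg_zero, Real.exp_zero] at h
  rw [← h, annularPiece_eq_intervalIntegral hr, intervalIntegral.integral_symm,
    ← intervalIntegral.integral_neg]
  refine intervalIntegral.integral_congr fun s _ => ?_
  have hs : (Real.exp (-s) : ℂ) ≠ 0 := by exact_mod_cast (Real.exp_pos (-s)).ne'
  have he : ∀ c : ℝ, |Real.exp (-s)| ^ (-c) = Real.exp (c * s) := fun c => by
    rw [Real.abs_exp, ← Real.exp_mul]
    congr 1
    ring
  simp only [Function.comp, he, Complex.real_smul, Complex.ofReal_neg, neg_mul, neg_neg]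
  rw [← mul_assoc, ← mul_assoc, ← mul_assoc, mul_inv_cancel₀ hs, one_mul]

theorem setIntegral_singularKernel_eq (hγ : Continuous γ)
    {f : EuclideanSpace ℝ (Fin d) → ℂ} (hf : Continuous f) {r : ℝ} (hr : 0 ≤ r)
    (x : EuclideanSpace ℝ (Fin d)) :
    ∫ t in {t : ℝ | Real.exp (-r) ≤ |t| ∧ |t| ≤ 1}, (t : ℂ)⁻¹ * ((|t| ^ (-α) : ℝ) : ℂ) *
        Complex.exp (Complex.I * ((|t| ^ (-β) : ℝ) : ℂ)) * f (x - γ t) =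
      annularPiece γ α β 0 r f x - annularPiece (fun t => γ (-t)) α β 0 r f x := by
  set ε := Real.exp (-r) with hε
  have hε0 : 0 < ε := Real.exp_pos _
  have hε1 : ε ≤ 1 := Real.exp_le_one_iff.2 (by linarith)
  have hset : {t : ℝ | ε ≤ |t| ∧ |t| ≤ 1} = Set.Icc ε 1 ∪ Set.Icc (-1) (-ε) := by
    ext t
    simp only [Set.mem_ofPred_eq, Set.mem_union, Set.mem_Icc]
    rcases abs_cases t with ⟨h, h'⟩ | ⟨h, h'⟩ <;> rw [h] <;> constructor
    · exact fun h => Or.inl h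
    · rintro (h | h)
      · exact h
      · constructor <;> linarith [h.2]
    · exact fun h => Or.inr ⟨by linarith [h.2], by linarith [h.1]⟩
    · rintro (h | h)
      · linarith [h.1]
      · exact ⟨by linarith [h.2], by linarith [h.1]⟩
  have hdisj : Disjoint (Set.Icc ε 1) (Set.Icc (-1) (-ε)) :=
    Set.disjoint_left.2 fun t h1 h2 => by linarith [h1.1, h2.2]
  have hc := continuousOn_singularKernel (α := α) (β := β) hγ hf x
  rw [hset, setIntegral_union hdisj measurableSet_Icc
    ((hc.mono fun t ht => (hε0.trans_le ht.1).ne').integrableOn_Icc)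
    ((hc.mono fun t ht => (by linarith [ht.2] : t < 0).ne).integrableOn_Icc),
    integral_Icc_eq_integral_Ioc, integral_Icc_eq_integral_Ioc,
    ← intervalIntegral.integral_of_le hε1, ← intervalIntegral.integral_of_le (by linarith),
    integral_exp_neg_one_eq_annularPiece hγ hf hr, ← intervalIntegral.integral_comp_neg,
    ← integral_exp_neg_one_eq_annularPiece (γ := fun t => γ (-t))
      (hγ.comp continuous_neg) hf hr, sub_eq_add_neg,
    ← intervalIntegral.integral_neg]
  simp only [abs_neg, Complex.ofReal_neg, inv_neg, neg_mul, hε]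

theorem IsWellCurved.exists_eLpNorm_truncation_le (hγ : IsWellCurved d γ) (hα : 0 ≤ α)
    (hβ : 0 < β) {p : ℝ} (hp : 1 < p) (hδ : 0 < β / (d + 1) * (1 - |2 / p - 1|) - α) :
    ∃ h₀, 0 < h₀ ∧ ∀ h, 0 < h → h ≤ h₀ → ∃ C, 0 ≤ C ∧ ∀ (n : ℕ)
      (f : 𝓢(EuclideanSpace ℝ (Fin d), ℂ)),
      eLpNorm (annularPiece γ α β 0 (n * h) f) (ENNReal.ofReal p) volume ≤
        ENNReal.ofReal C * eLpNorm f (ENNReal.ofReal p) volume := by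
  obtain ⟨h₀, hh₀, H⟩ := hγ.exists_eLpNorm_annularPiece_le hα hβ hp
  set δ := β / (d + 1) * (1 - |2 / p - 1|) - α
  refine ⟨h₀, hh₀, fun h hh hhh => ?_⟩
  obtain ⟨K, hK, HK⟩ := H h hh hhh
  have hq : Real.exp (-δ * h) < 1 := Real.exp_lt_one_iff.2 (by nlinarith)
  refine ⟨K * (1 - Real.exp (-δ * h))⁻¹, by
    have := sub_pos.2 hq
    positivity, fun n f => ?_⟩
  have hsum : annularPiece γ α β 0 (n * h) f =
      ∑ j ∈ Finset.range n, annularPiece γ α β (j * h) (j * h + h) f := by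
    ext x
    rw [Finset.sum_apply, sum_annularPiece hγ.1.continuous f.continuous hh.le]
  have hmeas : ∀ u v, AEStronglyMeasurable (annularPiece γ α β u v f) volume := fun u v =>
    (measurable_translationAverage (by fun_prop)
      (hγ.1.continuous.measurable.comp (by fun_prop))
      f.continuous.measurable).aestronglyMeasurable
  rw [hsum]
  refine (eLpNorm_sum_le (fun j _ => hmeas _ _)
    (by simpa using ENNReal.ofReal_le_ofReal hp.le)).trans ?_
  refine (Finset.sum_le_sum fun (j : ℕ) _ => HK (j * h) (by positivity) f).trans ?_
  rw [← Finset.sum_mul, ← ENNReal.ofReal_sum_of_nonneg fun j _ =>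
    mul_nonneg hK (Real.exp_pos _).le]
  gcongr
  rw [← Finset.mul_sum]
  gcongr
  rw [← tsum_geometric_of_lt_one (Real.exp_pos _).le hq]
  have e : ∀ j : ℕ, Real.exp (-δ * (j * h)) = Real.exp (-δ * h) ^ j := fun j => by
    rw [← Real.exp_nat_mul]
    congr 1
    ring
  simp only [e]
  exact (summable_geometric_of_lt_one (Real.exp_pos _).le hq).sum_le_tsum _
    fun j _ => pow_nonneg (Real.exp_pos _).le j

end Assembly

/-- For well-curved `γ`, `α, β > 0` and `1 < p < ∞` with
`α(d+1)/β < 1 - 2|1/p - 1/2|`, the strongly singular integral `T_γ` is bounded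
on `L^p(ℝ^d)`. -/
theorem strongly_singular_Lp_bound
    (d : ℕ) (hd : 0 < d) (γ : ℝ → EuclideanSpace ℝ (Fin d)) (hγ : IsWellCurved d γ)
    (α β : ℝ) (hα : 0 < α) (hβ : 0 < β)
    (p : ℝ) (hp1 : 1 < p)
    (hcrit : α * (d + 1) / β < 1 - 2 * |1 / p - 1 / 2|)
    (T : SchwartzMap (EuclideanSpace ℝ (Fin d)) ℂ → EuclideanSpace ℝ (Fin d) → ℂ)
    (hT : IsStronglySingularIntegralAlong d γ α β T) :
    ∃ C : ℝ, 0 < C ∧ ∀ f : SchwartzMap (EuclideanSpace ℝ (Fin d)) ℂ,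
      eLpNorm (T f) (ENNReal.ofReal p) volume ≤
        ENNReal.ofReal C * eLpNorm (⇑f) (ENNReal.ofReal p) volume := by
  have hδ : 0 < β / (d + 1) * (1 - |2 / p - 1|) - α := by
    have e : 2 * |1 / p - 1 / 2| = |2 / p - 1| := by
      rw [← abs_two, ← abs_mul]
      congr 1
      ring
    rw [e, div_lt_iff₀ hβ] at hcrit
    rw [sub_pos, div_mul_eq_mul_div, lt_div_iff₀ (by positivity)]
    linarith
  have hγc : Continuous γ := hγ.1.continuous
  obtain ⟨h₁, hh₁, H₁⟩ := hγ.exists_eLpNorm_truncation_le hα.le hβ hp1 hδ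
  obtain ⟨h₂, hh₂, H₂⟩ := hγ.comp_neg.exists_eLpNorm_truncation_le hα.le hβ hp1 hδ
  have hh : 0 < min h₁ h₂ := lt_min hh₁ hh₂
  obtain ⟨C₁, hC₁, H₁⟩ := H₁ _ hh (min_le_left _ _)
  obtain ⟨C₂, hC₂, H₂⟩ := H₂ _ hh (min_le_right _ _)
  set h := min h₁ h₂
  refine ⟨C₁ + C₂ + 1, by positivity, fun f => ?_⟩
  have hmeas : ∀ {Γ : ℝ → EuclideanSpace ℝ (Fin d)}, Continuous Γ → ∀ v,
      AEStronglyMeasurable (annularPiece Γ α β 0 v f) volume := fun hΓ v =>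
    (measurable_translationAverage (by fun_prop) (hΓ.measurable.comp (by fun_prop))
      f.continuous.measurable).aestronglyMeasurable
  have hm₁ := hmeas hγc
  have hm₂ := hmeas (hγc.comp continuous_neg)
  have hε : Tendsto (fun n : ℕ => Real.exp (-(n * h))) atTop (𝓝[>] 0) :=
    tendsto_nhdsWithin_iff.2 ⟨Real.tendsto_exp_neg_atTop_nhds_zero.comp
      (tendsto_natCast_atTop_atTop.atTop_mul_const hh),
      Eventually.of_forall fun _ => Real.exp_pos _⟩
  refine Lp.eLpNorm_le_of_ae_tendsto (u := atTop) (f := fun n : ℕ =>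
    annularPiece γ α β 0 (n * h) f - annularPiece (fun t => γ (-t)) α β 0 (n * h) f)
    (Eventually.of_forall fun n => ?_) (fun n => (hm₁ _).sub (hm₂ _))
    (Eventually.of_forall fun x => ?_)
  · refine (eLpNorm_sub_le (hm₁ _) (hm₂ _)
      (by simpa using ENNReal.ofReal_le_ofReal hp1.le)).trans ?_
    refine (add_le_add (H₁ n f) (H₂ n f)).trans ?_
    rw [← add_mul, ← ENNReal.ofReal_add hC₁ hC₂]
    exact mul_le_mul_left (ENNReal.ofReal_le_ofReal (by linarith)) _
  · refine ((hT f x).comp hε).congr fun n => ?_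
    exact setIntegral_singularKernel_eq hγc f.continuous (by positivity) x
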